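/- arXiv:2012.00861 — 9 statements merged into one kernel-verified Lean document; each statement's English description precedes it below -/
import Mathlib

section
/- Let T_L > 0 and let ζ : [0, T_L] → ℝ be continuous and positive. Suppose λ ∈ ℂ and u, û : [0, T_L] → ℂ are continuously differentiable, not both identically zero, and satisfy ζ(T)·û′(T) = λ·u(T) and u′(T) = λ·ζ(T)·û(T) for all T ∈ [0, T_L], together with either the boundary conditions û(0) = 0 and u(T_L) = 0, or the boundary conditions u(0) = 0 and u(T_L) = 0. Then λ is purely imaginary, i.e. Re λ = 0. -/
open Set

/-- A function with nonnegative derivative on `[a, b]` that vanishes at both endpoints has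
vanishing derivative throughout `[a, b]`. -/
theorem deriv_eq_zero_of_nonneg_of_endpoints {a b : ℝ} (hab : a < b) {g g' : ℝ → ℝ}
    (hg : ∀ t ∈ Icc a b, HasDerivAt g (g' t) t) (hg' : ∀ t ∈ Icc a b, 0 ≤ g' t)
    (ha : g a = 0) (hb : g b = 0) : ∀ t ∈ Icc a b, g' t = 0 := by
  have hmono : MonotoneOn g (Icc a b) := by
    refine monotoneOn_of_deriv_nonneg (convex_Icc a b)
      (fun t ht => (hg t ht).continuousAt.continuousWithinAt)
      (fun t ht => (hg t (interior_subset ht)).differentiableAt.differentiableWithinAt)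
      (fun t ht => ?_)
    rw [(hg t (interior_subset ht)).deriv]
    exact hg' t (interior_subset ht)
  have hzero : ∀ t ∈ Icc a b, g t = 0 := fun t ht =>
    le_antisymm (hb ▸ hmono ht (right_mem_Icc.2 hab.le) ht.2)
      (ha ▸ hmono (left_mem_Icc.2 hab.le) ht ht.1)
  intro t ht
  exact (uniqueDiffOn_Icc hab t ht).eq_deriv _ (hg t ht).hasDerivWithinAt
    ((hasDerivWithinAt_const t _ (0 : ℝ)).congr hzero (hzero t ht))

/- STATEMENT 0: eigenvalues of the operator L_ζ(u, û) = (ζ û′, ζ⁻¹ u′) with either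
   set of boundary conditions are purely imaginary. -/
theorem stmt0 (TL : ℝ) (hTL : 0 < TL) (ζ : ℝ → ℝ)
    (hζc : ContinuousOn ζ (Icc 0 TL))
    (hζpos : ∀ T ∈ Icc 0 TL, 0 < ζ T)
    (lam : ℂ) (u uh u' uh' : ℝ → ℂ)
    (hu : ∀ T ∈ Icc 0 TL, HasDerivAt u (u' T) T)
    (huh : ∀ T ∈ Icc 0 TL, HasDerivAt uh (uh' T) T)
    (hu'c : ContinuousOn u' (Icc 0 TL))
    (huh'c : ContinuousOn uh' (Icc 0 TL))
    (hnz : ¬ (∀ T ∈ Icc 0 TL, u T = 0 ∧ uh T = 0))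
    (heq1 : ∀ T ∈ Icc 0 TL, (ζ T : ℂ) * uh' T = lam * u T)
    (heq2 : ∀ T ∈ Icc 0 TL, u' T = lam * (ζ T : ℂ) * uh T)
    (hbc : (uh 0 = 0 ∧ u TL = 0) ∨ (u 0 = 0 ∧ u TL = 0)) :
    lam.re = 0 := by
  by_contra hre
  have hderiv : ∀ T ∈ Icc 0 TL,
      HasDerivAt (fun t => lam.re * ((u t).re * (uh t).re + (u t).im * (uh t).im))
        (lam.re ^ 2 * (ζ T * Complex.normSq (uh T) + Complex.normSq (u T) / ζ T)) T := by
    intro T hT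
    have hζ : ζ T ≠ 0 := (hζpos T hT).ne'
    have hre_deriv {f : ℝ → ℂ} {f' : ℂ} (h : HasDerivAt f f' T) :
        HasDerivAt (fun t => (f t).re) f'.re T :=
      Complex.reCLM.hasFDerivAt.comp_hasDerivAt T h
    have him_deriv {f : ℝ → ℂ} {f' : ℂ} (h : HasDerivAt f f' T) :
        HasDerivAt (fun t => (f t).im) f'.im T :=
      Complex.imCLM.hasFDerivAt.comp_hasDerivAt T h
    have h := (((hre_deriv (hu T hT)).mul (hre_deriv (huh T hT))).add
      ((him_deriv (hu T hT)).mul (him_deriv (huh T hT)))).const_mul lam.re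
    have e1 := congrArg Complex.re (heq1 T hT)
    have e2 := congrArg Complex.im (heq1 T hT)
    simp only [Complex.mul_re, Complex.mul_im, Complex.ofReal_re, Complex.ofReal_im,
      zero_mul, sub_zero, add_zero] at e1 e2
    have e1' := eq_div_of_mul_eq hζ ((mul_comm _ _).trans e1)
    have e2' := eq_div_of_mul_eq hζ ((mul_comm _ _).trans e2)
    refine h.congr_deriv ?_
    rw [heq2 T hT, e1', e2']
    simp only [Complex.mul_re, Complex.mul_im, Complex.ofReal_re, Complex.ofReal_im,
      Complex.normSq_apply]
    field_simp
    ring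
  have hnn : ∀ T ∈ Icc 0 TL, 0 ≤ ζ T * Complex.normSq (uh T) ∧
      0 ≤ Complex.normSq (u T) / ζ T := fun T hT =>
    ⟨mul_nonneg (hζpos T hT).le (Complex.normSq_nonneg _),
      div_nonneg (Complex.normSq_nonneg _) (hζpos T hT).le⟩
  have hzero := deriv_eq_zero_of_nonneg_of_endpoints hTL hderiv
    (fun T hT => mul_nonneg (sq_nonneg _) (add_nonneg (hnn T hT).1 (hnn T hT).2))
    (by rcases hbc with ⟨h, -⟩ | ⟨h, -⟩ <;> simp [h])
    (by rcases hbc with ⟨-, h⟩ | ⟨-, h⟩ <;> simp [h])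
  refine hnz fun T hT => ?_
  have hsum := (mul_eq_zero.1 (hzero T hT)).resolve_left (pow_ne_zero 2 hre)
  obtain ⟨h1, h2⟩ := (add_eq_zero_iff_of_nonneg (hnn T hT).1 (hnn T hT).2).1 hsum
  have hζ : ζ T ≠ 0 := (hζpos T hT).ne'
  exact ⟨Complex.normSq_eq_zero.1 ((div_eq_zero_iff.1 h2).resolve_right hζ),
    Complex.normSq_eq_zero.1 ((mul_eq_zero.1 h1).resolve_left hζ)⟩
end

section
/- Let T_L > 0, ζ₀ > 0, s ∈ ℂ, let ζ : [0, T_L] → ℝ be twice differentiable and positive, and let r : [0, T_L] → ℝ. Suppose u, û : [0, T_L] → ℂ are differentiable and satisfy û′(T) = −(s + r(T))·u(T)/ζ(T) and u′(T) = −s·ζ(T)·û(T) for all T ∈ [0, T_L]. Then the function w(T) = √(ζ₀/ζ(T))·u(T) is twice differentiable and satisfies the Schrödinger equation w″(T) = (s² + s·r(T) + q(T))·w(T) for all T ∈ [0, T_L], where q(T) = ζ(T)^{1/2} · (d²/dT²)(ζ(T)^{-1/2}). -/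
open Set

/-- Two functions agreeing on a nondegenerate interval have equal derivatives there, also at
the endpoints. -/
theorem HasDerivAt.unique_of_eqOn_Icc {a b x f' g' : ℝ} {f g : ℝ → ℝ} (hab : a < b)
    (hx : x ∈ Icc a b) (hf : HasDerivAt f f' x) (hg : HasDerivAt g g' x)
    (h : EqOn f g (Icc a b)) : f' = g' :=
  (uniqueDiffOn_Icc hab x hx).eq_deriv _ hf.hasDerivWithinAt
    (hg.hasDerivWithinAt.congr h (h hx))

/- STATEMENT 3: the Liouville transformation w = √(ζ₀/ζ)·u converts the first-order wave
   system into the Schrödinger equation w″ = (s² + s r + q) w with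
   q = ζ^{1/2}·(ζ^{-1/2})″. -/
theorem stmt3 (TL : ℝ) (hTL : 0 < TL) (ζ0 : ℝ) (hζ0 : 0 < ζ0) (s : ℂ)
    (ζ ζ' ζ'' : ℝ → ℝ)
    (hζd : ∀ T ∈ Icc 0 TL, HasDerivAt ζ (ζ' T) T)
    (hζd2 : ∀ T ∈ Icc 0 TL, HasDerivAt ζ' (ζ'' T) T)
    (hζpos : ∀ T ∈ Icc 0 TL, 0 < ζ T)
    (r : ℝ → ℝ)
    (g g' g'' q : ℝ → ℝ)
    (hg : ∀ T ∈ Icc 0 TL, g T = (Real.sqrt (ζ T))⁻¹)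
    (hgd : ∀ T ∈ Icc 0 TL, HasDerivAt g (g' T) T)
    (hgd2 : ∀ T ∈ Icc 0 TL, HasDerivAt g' (g'' T) T)
    (hq : ∀ T ∈ Icc 0 TL, q T = Real.sqrt (ζ T) * g'' T)
    (u uh u' uh' : ℝ → ℂ)
    (hu : ∀ T ∈ Icc 0 TL, HasDerivAt u (u' T) T)
    (huh : ∀ T ∈ Icc 0 TL, HasDerivAt uh (uh' T) T)
    (heq1 : ∀ T ∈ Icc 0 TL, uh' T = -(s + (r T : ℂ)) * u T / (ζ T : ℂ))
    (heq2 : ∀ T ∈ Icc 0 TL, u' T = -s * (ζ T : ℂ) * uh T) :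
    ∃ w' w'' : ℝ → ℂ,
      (∀ T ∈ Icc 0 TL,
        HasDerivAt (fun t : ℝ => (Real.sqrt (ζ0 / ζ t) : ℂ) * u t) (w' T) T) ∧
      (∀ T ∈ Icc 0 TL, HasDerivAt w' (w'' T) T) ∧
      (∀ T ∈ Icc 0 TL,
        w'' T = (s ^ 2 + s * (r T : ℂ) + (q T : ℂ)) *
          ((Real.sqrt (ζ0 / ζ T) : ℂ) * u T)) := by
  set k : ℝ := Real.sqrt ζ0
  have hsplit : ∀ T ∈ Icc 0 TL, Real.sqrt (ζ0 / ζ T) = k * g T := fun T hT => by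
    rw [hg T hT, Real.sqrt_div hζ0.le, div_eq_mul_inv]
  have hgsq : ∀ T ∈ Icc 0 TL, g T ^ 2 * ζ T = 1 := fun T hT => by
    rw [hg T hT, inv_pow, Real.sq_sqrt (hζpos T hT).le, inv_mul_cancel₀ (hζpos T hT).ne']
  have hcoeff : ∀ T ∈ Icc 0 TL, 2 * g' T * ζ T + g T * ζ' T = 0 := fun T hT => by
    have h := (((hgd T hT).pow 2).mul (hζd T hT)).unique_of_eqOn_Icc hTL hT
      (hasDerivAt_const T (1 : ℝ)) hgsq
    have hne : g T ≠ 0 := fun h0 => by simpa [h0] using hgsq T hT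
    apply mul_left_cancel₀ hne
    simp only [Pi.pow_apply] at h
    push_cast at h
    linear_combination h
  refine ⟨fun t => (k : ℂ) * ((g' t : ℂ) * u t + (g t : ℂ) * (-s * (ζ t : ℂ) * uh t)),
    fun t => (k : ℂ) * (((g'' t : ℂ) * u t + (g' t : ℂ) * u' t) +
      ((g' t : ℂ) * (-s * (ζ t : ℂ) * uh t) +
        (g t : ℂ) * (-s * (ζ' t : ℂ) * uh t + -s * (ζ t : ℂ) * uh' t))),
    fun T hT => ?_, fun T hT => ?_, fun T hT => ?_⟩
  · have hpos := hζpos T hT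
    have hdiff : DifferentiableAt ℝ (fun t => Real.sqrt (ζ0 / ζ t)) T :=
      ((differentiableAt_const ζ0).div (hζd T hT).differentiableAt hpos.ne').sqrt
        (div_pos hζ0 hpos).ne'
    have hderiv := hdiff.hasDerivAt
    rw [hderiv.unique_of_eqOn_Icc hTL hT ((hgd T hT).const_mul k) hsplit] at hderiv
    refine (hderiv.ofReal_comp.mul (hu T hT)).congr_deriv ?_
    rw [hsplit T hT, heq2 T hT]
    push_cast
    ring
  · exact ((((hgd2 T hT).ofReal_comp.mul (hu T hT)).add
      ((hgd T hT).ofReal_comp.mul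
        (((hζd T hT).ofReal_comp.const_mul (-s)).mul (huh T hT)))).const_mul (k : ℂ))
  · have hζne : (ζ T : ℂ) ≠ 0 := by exact_mod_cast (hζpos T hT).ne'
    have hqg : (q T : ℂ) * (g T : ℂ) = (g'' T : ℂ) := by
      have hsq : Real.sqrt (ζ T) ≠ 0 := (Real.sqrt_pos.2 (hζpos T hT)).ne'
      have h : q T * g T = g'' T := by
        rw [hq T hT, hg T hT]
        field_simp
      exact_mod_cast h
    have hc : 2 * (g' T : ℂ) * (ζ T : ℂ) + (g T : ℂ) * (ζ' T : ℂ) = 0 := by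
      exact_mod_cast hcoeff T hT
    have huh' : (ζ T : ℂ) * uh' T = -(s + (r T : ℂ)) * u T := by
      rw [heq1 T hT, mul_div_cancel₀ _ hζne]
    beta_reduce
    rw [hsplit T hT, heq2 T hT]
    push_cast
    linear_combination (-(k : ℂ) * u T) * hqg - (k : ℂ) * s * uh T * hc -
      (k : ℂ) * (g T : ℂ) * s * huh'
end

section
/- Let T_L > 0, let ζ : [0, T_L] → ℝ be continuously differentiable and positive, set c(T) = −ζ′(T)/(2ζ(T)), and let r : [0, T_L] → ℝ be continuous with r(T) ≥ 0 for all T. Suppose λ ∈ ℂ and w, ŵ : [0, T_L] → ℂ are continuously differentiable, not both identically zero, and satisfy ŵ′(T) + c(T)·ŵ(T) + (r(T) + λ)·w(T) = 0 and w′(T) − c(T)·w(T) + λ·ŵ(T) = 0 for all T ∈ [0, T_L], together with the boundary conditions ŵ(0) = 0 and w(T_L) = 0. Then Re λ ≤ 0. -/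
open Set

/-- A function whose derivative is nonpositive on a nondegenerate interval and whose values at the
two endpoints agree has zero derivative on the whole interval. -/
theorem hasDerivAt_eq_zero_of_nonpos_of_endpoints_eq {a b : ℝ} (hab : a < b) {f f' : ℝ → ℝ}
    (hf : ∀ x ∈ Icc a b, HasDerivAt f (f' x) x) (hf' : ∀ x ∈ Icc a b, f' x ≤ 0)
    (hend : f a = f b) : ∀ x ∈ Icc a b, f' x = 0 := by
  have hanti : AntitoneOn f (Icc a b) :=
    antitoneOn_of_hasDerivWithinAt_nonpos (convex_Icc a b)
      (fun x hx => (hf x hx).continuousAt.continuousWithinAt)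
      (fun x hx => (hf x (interior_subset hx)).hasDerivWithinAt)
      (fun x hx => hf' x (interior_subset hx))
  have hconst : ∀ x ∈ Icc a b, f x = f a := fun x hx =>
    le_antisymm (hanti (left_mem_Icc.2 hab.le) hx hx.1)
      (hend ▸ hanti hx (right_mem_Icc.2 hab.le) hx.2)
  intro x hx
  exact (uniqueDiffOn_Icc hab x hx).eq_deriv _ (hf x hx).hasDerivWithinAt
    ((hasDerivWithinAt_const x (Icc a b) (f a)).congr hconst (hconst x hx))

/-- The derivative of the power flow `Re (u * conj v)`, written in real and imaginary parts. -/
theorem hasDerivAt_re_mul_re_add_im_mul_im {u v : ℝ → ℂ} {u' v' : ℂ} {t : ℝ}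
    (hu : HasDerivAt u u' t) (hv : HasDerivAt v v' t) :
    HasDerivAt (fun s => (u s).re * (v s).re + (u s).im * (v s).im)
      (u'.re * (v t).re + (u t).re * v'.re + (u'.im * (v t).im + (u t).im * v'.im)) t := by
  have hre {g : ℝ → ℂ} {g' : ℂ} (h : HasDerivAt g g' t) :
      HasDerivAt (fun s => (g s).re) g'.re t :=
    Complex.reCLM.hasFDerivAt.comp_hasDerivAt t h
  have him {g : ℝ → ℂ} {g' : ℂ} (h : HasDerivAt g g' t) :
      HasDerivAt (fun s => (g s).im) g'.im t :=
    Complex.imCLM.hasFDerivAt.comp_hasDerivAt t h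
  exact ((hre hu).mul (hre hv)).add ((him hu).mul (him hv))

/- STATEMENT 5: stability — the eigenvalues of the Liouville-transformed first-order
   system with nonnegative loss lie in the closed left half plane. -/
theorem stmt5 (TL : ℝ) (hTL : 0 < TL) (ζ ζ' : ℝ → ℝ)
    (hζd : ∀ T ∈ Icc 0 TL, HasDerivAt ζ (ζ' T) T)
    (hζ'c : ContinuousOn ζ' (Icc 0 TL))
    (hζpos : ∀ T ∈ Icc 0 TL, 0 < ζ T)
    (c : ℝ → ℝ) (hc : ∀ T ∈ Icc 0 TL, c T = -ζ' T / (2 * ζ T))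
    (r : ℝ → ℝ) (hrc : ContinuousOn r (Icc 0 TL))
    (hrpos : ∀ T ∈ Icc 0 TL, 0 ≤ r T)
    (lam : ℂ) (w wh w' wh' : ℝ → ℂ)
    (hw : ∀ T ∈ Icc 0 TL, HasDerivAt w (w' T) T)
    (hwh : ∀ T ∈ Icc 0 TL, HasDerivAt wh (wh' T) T)
    (hw'c : ContinuousOn w' (Icc 0 TL))
    (hwh'c : ContinuousOn wh' (Icc 0 TL))
    (hnz : ¬ (∀ T ∈ Icc 0 TL, w T = 0 ∧ wh T = 0))
    (heq1 : ∀ T ∈ Icc 0 TL,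
      wh' T + (c T : ℂ) * wh T + ((r T : ℂ) + lam) * w T = 0)
    (heq2 : ∀ T ∈ Icc 0 TL,
      w' T - (c T : ℂ) * w T + lam * wh T = 0)
    (hbc : wh 0 = 0 ∧ w TL = 0) :
    lam.re ≤ 0 := by
  by_contra! hlam
  have hpower : ∀ T ∈ Icc 0 TL,
      (w' T).re * (wh T).re + (w T).re * (wh' T).re
        + ((w' T).im * (wh T).im + (w T).im * (wh' T).im)
      = -((r T + lam.re) * Complex.normSq (w T) + lam.re * Complex.normSq (wh T)) := by
    intro T hT
    have h1 := heq1 T hT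
    have h2 := heq2 T hT
    have h1r := congrArg Complex.re h1
    have h1i := congrArg Complex.im h1
    have h2r := congrArg Complex.re h2
    have h2i := congrArg Complex.im h2
    simp at h1r h1i h2r h2i
    simp only [Complex.normSq_apply]
    linear_combination (wh T).re * h2r + (wh T).im * h2i + (w T).re * h1r + (w T).im * h1i
  have hnonneg : ∀ T ∈ Icc 0 TL, 0 ≤ (r T + lam.re) * Complex.normSq (w T) := fun T hT =>
    mul_nonneg (add_nonneg (hrpos T hT) hlam.le) (Complex.normSq_nonneg _)
  have hnonneg' : ∀ T, 0 ≤ lam.re * Complex.normSq (wh T) := fun T =>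
    mul_nonneg hlam.le (Complex.normSq_nonneg _)
  have hzero := hasDerivAt_eq_zero_of_nonpos_of_endpoints_eq hTL
    (fun T hT => hasDerivAt_re_mul_re_add_im_mul_im (hw T hT) (hwh T hT))
    (fun T hT => by linarith [hpower T hT, hnonneg T hT, hnonneg' T])
    (by simp [hbc.1, hbc.2])
  refine hnz fun T hT => ?_
  have hsum := (hpower T hT).symm.trans (hzero T hT)
  have hw0 : (r T + lam.re) * Complex.normSq (w T) = 0 := by
    linarith [hnonneg T hT, hnonneg' T]
  have hwh0 : lam.re * Complex.normSq (wh T) = 0 := by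
    linarith [hnonneg T hT, hnonneg' T]
  exact ⟨Complex.normSq_eq_zero.1
      ((mul_eq_zero.1 hw0).resolve_left (add_pos_of_nonneg_of_pos (hrpos T hT) hlam).ne'),
    Complex.normSq_eq_zero.1 ((mul_eq_zero.1 hwh0).resolve_left hlam.ne')⟩
end

section
/- Let T_L > 0, ζ₀ > 0, let ζ : [0, T_L] → ℝ be continuously differentiable and positive, set c(T) = −ζ′(T)/(2ζ(T)), let r : [0, T_L] → ℝ be continuous with r(T) ≥ 0, and let s ∈ ℂ with Re s ≥ 0. Suppose w, ŵ : [0, T_L] → ℂ are continuously differentiable and satisfy ŵ′(T) + c(T)·ŵ(T) + (r(T) + s)·w(T) = 0 and w′(T) − c(T)·w(T) + s·ŵ(T) = 0 for all T ∈ [0, T_L], with boundary conditions w(T_L) = 0 and ŵ(0) = ζ₀. Then ζ₀ · Re(w(0)) = ∫₀^{T_L} [ Re(s)·|ŵ(T)|² + (r(T) + Re(s))·|w(T)|² ] dT; in particular Re(w(0)) ≥ 0. -/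
open Set

/-- The derivative of the energy flux `Re (u * conj v)`, in real coordinates. -/
theorem hasDerivAt_re_mul_conj {u v : ℝ → ℂ} {u' v' : ℂ} {t : ℝ}
    (hu : HasDerivAt u u' t) (hv : HasDerivAt v v' t) :
    HasDerivAt (fun x => (u x).re * (v x).re + (u x).im * (v x).im)
      (u'.re * (v t).re + (u t).re * v'.re + (u'.im * (v t).im + (u t).im * v'.im)) t := by
  have re {f : ℝ → ℂ} {f' : ℂ} (h : HasDerivAt f f' t) :
      HasDerivAt (fun x => (f x).re) f'.re t :=
    Complex.reCLM.hasFDerivAt.comp_hasDerivAt t h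
  have im {f : ℝ → ℂ} {f' : ℂ} (h : HasDerivAt f f' t) :
      HasDerivAt (fun x => (f x).im) f'.im t :=
    Complex.imCLM.hasFDerivAt.comp_hasDerivAt t h
  exact ((re hu).mul (re hv)).add ((im hu).mul (im hv))

/-- The energy flux dissipates pointwise: the coupling `c` cancels. -/
theorem flux_deriv_eq_neg_dissipation {u v u' v' s : ℂ} {c r : ℝ}
    (hv : v' + (c : ℂ) * v + ((r : ℂ) + s) * u = 0) (hu : u' - (c : ℂ) * u + s * v = 0) :
    u'.re * v.re + u.re * v'.re + (u'.im * v.im + u.im * v'.im) =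
      -(s.re * ‖v‖ ^ 2 + (r + s.re) * ‖u‖ ^ 2) := by
  have hv' : v' = -(c : ℂ) * v - ((r : ℂ) + s) * u := by linear_combination hv
  have hu' : u' = (c : ℂ) * u - s * v := by linear_combination hu
  subst hv' hu'
  rw [Complex.sq_norm, Complex.sq_norm, Complex.normSq_apply, Complex.normSq_apply]
  simp only [Complex.sub_re, Complex.sub_im, Complex.mul_re, Complex.mul_im, Complex.neg_re,
    Complex.neg_im, Complex.add_re, Complex.add_im, Complex.ofReal_re, Complex.ofReal_im]
  ring

/- STATEMENT 6: passivity identity — ζ₀·Re(w(0)) equals the dissipated energy integral,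
   so Re(w(0)) ≥ 0 for Re s ≥ 0. -/
theorem stmt6 (TL : ℝ) (hTL : 0 < TL) (ζ0 : ℝ) (hζ0 : 0 < ζ0)
    (ζ ζ' : ℝ → ℝ)
    (hζd : ∀ T ∈ Icc 0 TL, HasDerivAt ζ (ζ' T) T)
    (hζ'c : ContinuousOn ζ' (Icc 0 TL))
    (hζpos : ∀ T ∈ Icc 0 TL, 0 < ζ T)
    (c : ℝ → ℝ) (hc : ∀ T ∈ Icc 0 TL, c T = -ζ' T / (2 * ζ T))
    (r : ℝ → ℝ) (hrc : ContinuousOn r (Icc 0 TL))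
    (hrpos : ∀ T ∈ Icc 0 TL, 0 ≤ r T)
    (s : ℂ) (hs : 0 ≤ s.re)
    (w wh w' wh' : ℝ → ℂ)
    (hw : ∀ T ∈ Icc 0 TL, HasDerivAt w (w' T) T)
    (hwh : ∀ T ∈ Icc 0 TL, HasDerivAt wh (wh' T) T)
    (hw'c : ContinuousOn w' (Icc 0 TL))
    (hwh'c : ContinuousOn wh' (Icc 0 TL))
    (heq1 : ∀ T ∈ Icc 0 TL,
      wh' T + (c T : ℂ) * wh T + ((r T : ℂ) + s) * w T = 0)
    (heq2 : ∀ T ∈ Icc 0 TL,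
      w' T - (c T : ℂ) * w T + s * wh T = 0)
    (hbcL : w TL = 0) (hbc0 : wh 0 = (ζ0 : ℂ)) :
    ζ0 * (w 0).re =
      (∫ T in (0:ℝ)..TL, (s.re * ‖wh T‖ ^ 2 + (r T + s.re) * ‖w T‖ ^ 2)) ∧
    0 ≤ (w 0).re := by
  have hcont : ContinuousOn (fun T => s.re * ‖wh T‖ ^ 2 + (r T + s.re) * ‖w T‖ ^ 2)
      (Icc 0 TL) := by
    have hwc : ContinuousOn w (Icc 0 TL) := fun T hT => (hw T hT).continuousAt.continuousWithinAt
    have hwhc : ContinuousOn wh (Icc 0 TL) :=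
      fun T hT => (hwh T hT).continuousAt.continuousWithinAt
    fun_prop
  have hint := (hcont.intervalIntegrable_of_Icc (μ := MeasureTheory.volume) hTL.le).neg
  have hflux := intervalIntegral.integral_eq_sub_of_hasDerivAt
    (f := fun T => (w T).re * (wh T).re + (w T).im * (wh T).im)
    (fun T hT => by
      rw [uIcc_of_le hTL.le] at hT
      have h := hasDerivAt_re_mul_conj (hw T hT) (hwh T hT)
      rwa [flux_deriv_eq_neg_dissipation (heq1 T hT) (heq2 T hT)] at h) hint
  have hid : ζ0 * (w 0).re =
      ∫ T in (0:ℝ)..TL, (s.re * ‖wh T‖ ^ 2 + (r T + s.re) * ‖w T‖ ^ 2) := by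
    simp only [Pi.neg_apply, intervalIntegral.integral_neg] at hflux
    simp only [hbcL, hbc0, Complex.zero_re, Complex.zero_im, Complex.ofReal_re,
      Complex.ofReal_im] at hflux
    linarith
  refine ⟨hid, nonneg_of_mul_nonneg_right ?_ hζ0⟩
  rw [hid]
  refine intervalIntegral.integral_nonneg hTL.le fun T hT => ?_
  have := hrpos T hT
  positivity
end

section
/- Let n ≥ 1, let S ∈ M_n(ℝ) be skew-symmetric (Sᵀ = −S), let R ∈ M_n(ℝ) be symmetric positive semidefinite, let b ∈ ℝⁿ, and let s ∈ ℂ with Re s > 0. Then: (i) the complex matrix S + R + s·I is invertible; (ii) the transfer function value H(s) = bᵀ (S + R + s·I)^{-1} b satisfies Re H(s) ≥ 0; and (iii) H(conj(s)) = conj(H(s)). -/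
open Matrix

namespace Matrix

open scoped ComplexOrder

variable {ι : Type*} [Fintype ι]

/-- The real part of the sesquilinear form of a real matrix splits over real and imaginary parts. -/
lemma re_star_dotProduct_map_ofReal_mulVec (A : Matrix ι ι ℝ) (x : ι → ℂ) :
    (star x ⬝ᵥ (A.map Complex.ofReal *ᵥ x)).re =
      (fun i => (x i).re) ⬝ᵥ (A *ᵥ fun i => (x i).re) +
        (fun i => (x i).im) ⬝ᵥ (A *ᵥ fun i => (x i).im) := by
  simp [dotProduct, mulVec, Finset.sum_add_distrib]

lemma dotProduct_mulVec_self_eq_zero_of_transpose_eq_neg {S : Matrix ι ι ℝ} (hS : Sᵀ = -S)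
    (u : ι → ℝ) : u ⬝ᵥ (S *ᵥ u) = 0 := by
  have h : u ⬝ᵥ (S *ᵥ u) = -(u ⬝ᵥ (S *ᵥ u)) := by
    conv_lhs => rw [dotProduct_mulVec, ← mulVec_transpose, hS, neg_mulVec, neg_dotProduct,
      dotProduct_comm]
  linarith

lemma re_star_dotProduct_self_nonneg (x : ι → ℂ) : 0 ≤ (star x ⬝ᵥ x).re :=
  (Complex.nonneg_iff.mp (dotProduct_star_self_nonneg x)).1

variable [DecidableEq ι]

lemma re_star_dotProduct_mulVec_ge {S R : Matrix ι ι ℝ} (hS : Sᵀ = -S) (hR : R.PosSemidef)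
    (s : ℂ) (x : ι → ℂ) :
    s.re * (star x ⬝ᵥ x).re ≤ (star x ⬝ᵥ ((S.map Complex.ofReal + R.map Complex.ofReal +
      s • (1 : Matrix ι ι ℂ)) *ᵥ x)).re := by
  have hu := hR.dotProduct_mulVec_nonneg fun i => (x i).re
  have hv := hR.dotProduct_mulVec_nonneg fun i => (x i).im
  have him : (star x ⬝ᵥ x).im = 0 := (Complex.nonneg_iff.mp (dotProduct_star_self_nonneg x)).2.symm
  rw [star_trivial] at hu hv
  simp only [add_mulVec, dotProduct_add, smul_mulVec, one_mulVec, dotProduct_smul, smul_eq_mul,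
    Complex.add_re, Complex.mul_re, re_star_dotProduct_map_ofReal_mulVec,
    dotProduct_mulVec_self_eq_zero_of_transpose_eq_neg hS, him]
  linarith

lemma isUnit_det_skew_add_posSemidef_add_smul_one {S R : Matrix ι ι ℝ} (hS : Sᵀ = -S)
    (hR : R.PosSemidef) {s : ℂ} (hs : 0 < s.re) :
    IsUnit (S.map Complex.ofReal + R.map Complex.ofReal + s • (1 : Matrix ι ι ℂ)).det := by
  rw [isUnit_iff_ne_zero]
  intro hdet
  obtain ⟨x, hx, hMx⟩ := exists_mulVec_eq_zero_iff.mpr hdet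
  have h := re_star_dotProduct_mulVec_ge hS hR s x
  have hpos : 0 < (star x ⬝ᵥ x).re := (Complex.pos_iff.mp (dotProduct_star_self_pos_iff.mpr hx)).1
  rw [hMx, dotProduct_zero, Complex.zero_re] at h
  exact (mul_pos hs hpos).not_ge h

lemma map_starRingEnd_nonsing_inv (M : Matrix ι ι ℂ) :
    M⁻¹.map (starRingEnd ℂ) = (M.map (starRingEnd ℂ))⁻¹ := by
  change ((M⁻¹)ᴴ)ᵀ = ((Mᴴ)ᵀ)⁻¹
  rw [conjTranspose_nonsing_inv, transpose_nonsing_inv]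

end Matrix

/- STATEMENT 8: passivity of the finite-dimensional system with skew-symmetric part S,
   positive semidefinite loss R and real input/output vector b. -/
theorem stmt8 (n : ℕ) (hn : 1 ≤ n) (S R : Matrix (Fin n) (Fin n) ℝ)
    (hS : Sᵀ = -S) (hR : R.PosSemidef) (b : Fin n → ℝ)
    (s : ℂ) (hs : 0 < s.re) :
    IsUnit (S.map Complex.ofReal + R.map Complex.ofReal +
      s • (1 : Matrix (Fin n) (Fin n) ℂ)).det ∧
    0 ≤ ((fun i => (b i : ℂ)) ⬝ᵥ
      ((S.map Complex.ofReal + R.map Complex.ofReal +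
        s • (1 : Matrix (Fin n) (Fin n) ℂ))⁻¹ *ᵥ fun i => (b i : ℂ))).re ∧
    (fun i => (b i : ℂ)) ⬝ᵥ
      ((S.map Complex.ofReal + R.map Complex.ofReal +
        (starRingEnd ℂ s) • (1 : Matrix (Fin n) (Fin n) ℂ))⁻¹ *ᵥ fun i => (b i : ℂ))
      = starRingEnd ℂ ((fun i => (b i : ℂ)) ⬝ᵥ
          ((S.map Complex.ofReal + R.map Complex.ofReal +
            s • (1 : Matrix (Fin n) (Fin n) ℂ))⁻¹ *ᵥ fun i => (b i : ℂ))) := by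
  have hM := isUnit_det_skew_add_posSemidef_add_smul_one hS hR hs
  refine ⟨hM, ?_, ?_⟩
  · set M := S.map Complex.ofReal + R.map Complex.ofReal + s • (1 : Matrix (Fin n) (Fin n) ℂ)
      with hMdef
    set c : Fin n → ℂ := fun i => (b i : ℂ)
    have hc : star c = c := by ext i; simp [c]
    have hMx : M *ᵥ (M⁻¹ *ᵥ c) = c := by
      rw [mulVec_mulVec, mul_nonsing_inv M hM, one_mulVec]
    have h := re_star_dotProduct_mulVec_ge hS hR s (M⁻¹ *ᵥ c)
    rw [← hMdef, hMx, star_dotProduct _ c, hc] at h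
    have hpos : 0 ≤ (star (M⁻¹ *ᵥ c) ⬝ᵥ (M⁻¹ *ᵥ c)).re :=
      re_star_dotProduct_self_nonneg _
    simpa using (mul_nonneg hs.le hpos).trans h
  · have hc : (starRingEnd ℂ ∘ fun i => (b i : ℂ)) = fun i => (b i : ℂ) := by ext i; simp
    rw [RingHom.map_dotProduct, hc]
    congr 1
    ext i
    rw [Function.comp_apply, RingHom.map_mulVec, hc, map_starRingEnd_nonsing_inv]
    congr 3
    ext j k
    by_cases hjk : j = k <;> simp [hjk]
end

section
/- Let n ≥ 1, let γ₁, …, γ_n and γ̂₁, …, γ̂_n be positive reals, and let 𝔯₁, …, 𝔯_n and 𝔯̂₁, …, 𝔯̂_n be reals. Let 𝕋 ∈ M_{2n}(ℝ) be the tridiagonal matrix with diagonal entries 𝕋_{2j−1,2j−1} = 𝔯_j and 𝕋_{2j,2j} = −𝔯̂_j, superdiagonal entries 𝕋_{2j−1,2j} = 1/γ̂_j and 𝕋_{2j,2j+1} = −1/γ_j, and subdiagonal entries 𝕋_{2j,2j−1} = 1/γ_j and 𝕋_{2j+1,2j} = −1/γ̂_{j+1}. Let J = diag(1, −1, 1,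 −1, …, 1, −1) ∈ M_{2n}(ℝ), and let A ∈ M_{2n}(ℂ) be the complex symmetric tridiagonal matrix with diagonal entries A_{2j−1,2j−1} = 𝔯_j and A_{2j,2j} = 𝔯̂_j, and off-diagonal entries A_{2j−1,2j} = A_{2j,2j−1} = −i/√(γ_j γ̂_j) for j = 1,…,n and A_{2j,2j+1} = A_{2j+1,2j} = i/√(γ_j γ̂_{j+1}) for j = 1,…,n−1. Then for every s ∈ ℂ such that 𝕋 + s·J is invertible, the matrix A + s·I is also invertible, and the solution U ∈ ℂ^{2n} of (𝕋 + s·J)·U = e₁/γ̂₁ satisfies e₁ᵀ U = (1/γ̂₁)·e₁ᵀ (A + s·I)^{-1} e₁, where e₁ is the first standard basis vector. -/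
open Matrix

/-- If `diagonal c * M = B * diagonal d` with nonvanishing diagonals, then `B` is invertible
whenever `M` is. -/
theorem isUnit_det_of_diagonal_mul_eq {ι : Type*} [Fintype ι] [DecidableEq ι]
    {M B : Matrix ι ι ℂ} {c d : ι → ℂ} (hc : ∀ i, c i ≠ 0)
    (h : diagonal c * M = B * diagonal d) (hM : IsUnit M.det) : IsUnit B.det := by
  have hdet := congrArg det h
  rw [det_mul, det_mul, det_diagonal, det_diagonal] at hdet
  refine isUnit_iff_ne_zero.2 fun hB => ?_
  rw [hB, zero_mul] at hdet
  exact mul_ne_zero (Finset.prod_ne_zero_iff.2 fun i _ => hc i) hM.ne_zero hdet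

/-- If `diagonal c * M = B * diagonal d`, the solution of `M U = a eₖ` is read off from `B⁻¹`. -/
theorem apply_eq_mul_inv_apply_of_diagonal_mul_eq {ι : Type*} [Fintype ι] [DecidableEq ι]
    {M B : Matrix ι ι ℂ} {c d : ι → ℂ} {k : ι} (hk : c k = d k) (hd : d k ≠ 0)
    (h : diagonal c * M = B * diagonal d) (hB : IsUnit B.det) {U : ι → ℂ} {a : ℂ}
    (hU : M *ᵥ U = Pi.single k a) : U k = a * B⁻¹ k k := by
  have hv : diagonal d *ᵥ U = B⁻¹ *ᵥ Pi.single k (c k * a) := by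
    rw [← diagonal_mulVec_single, ← hU, mulVec_mulVec, mulVec_mulVec, Matrix.mul_assoc, h,
      nonsing_inv_mul_cancel_left _ _ hB]
  have hvk := congrFun hv k
  rw [mulVec_diagonal, mulVec_single] at hvk
  simp only [Pi.smul_apply, MulOpposite.smul_eq_mul_unop, MulOpposite.unop_op, col_apply, hk]
    at hvk
  exact mul_left_cancel₀ hd (by linear_combination hvk)

theorem stmt10 (n : ℕ) (hn : 1 ≤ n)
    (γ γh 𝔯 𝔯h : ℕ → ℝ)
    (hγ : ∀ j ∈ Finset.Icc 1 n, 0 < γ j)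
    (hγh : ∀ j ∈ Finset.Icc 1 n, 0 < γh j)
    (T : Matrix (Fin (2 * n)) (Fin (2 * n)) ℝ)
    (hT : ∀ p q : Fin (2 * n), T p q =
      if p = q then
        (if (p.val + 1) % 2 = 1 then 𝔯 ((p.val + 2) / 2) else -𝔯h ((p.val + 1) / 2))
      else if q.val = p.val + 1 then
        (if (p.val + 1) % 2 = 1 then (γh ((p.val + 2) / 2))⁻¹
          else -(γ ((p.val + 1) / 2))⁻¹)
      else if p.val = q.val + 1 then
        (if (q.val + 1) % 2 = 1 then (γ ((q.val + 2) / 2))⁻¹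
          else -(γh ((q.val + 1) / 2 + 1))⁻¹)
      else 0)
    (J : Matrix (Fin (2 * n)) (Fin (2 * n)) ℝ)
    (hJ : J = Matrix.diagonal (fun i : Fin (2 * n) =>
      if i.val % 2 = 0 then (1 : ℝ) else -1))
    (A : Matrix (Fin (2 * n)) (Fin (2 * n)) ℂ)
    (hA : ∀ p q : Fin (2 * n), A p q =
      if p = q then
        (if (p.val + 1) % 2 = 1 then ((𝔯 ((p.val + 2) / 2) : ℝ) : ℂ)
          else ((𝔯h ((p.val + 1) / 2) : ℝ) : ℂ))
      else if q.val = p.val + 1 then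
        (if (p.val + 1) % 2 = 1 then
          -Complex.I / (Real.sqrt (γ ((p.val + 2) / 2) * γh ((p.val + 2) / 2)) : ℂ)
        else
          Complex.I / (Real.sqrt (γ ((p.val + 1) / 2) * γh ((p.val + 1) / 2 + 1)) : ℂ))
      else if p.val = q.val + 1 then
        (if (q.val + 1) % 2 = 1 then
          -Complex.I / (Real.sqrt (γ ((q.val + 2) / 2) * γh ((q.val + 2) / 2)) : ℂ)
        else
          Complex.I / (Real.sqrt (γ ((q.val + 1) / 2) * γh ((q.val + 1) / 2 + 1)) : ℂ))
      else 0) :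
    ∀ s : ℂ,
      IsUnit (T.map Complex.ofReal + s • J.map Complex.ofReal).det →
      IsUnit (A + s • (1 : Matrix (Fin (2 * n)) (Fin (2 * n)) ℂ)).det ∧
      ∀ U : Fin (2 * n) → ℂ,
        ((T.map Complex.ofReal + s • J.map Complex.ofReal) *ᵥ U =
          fun i : Fin (2 * n) => if i.val = 0 then ((γh 1 : ℝ) : ℂ)⁻¹ else 0) →
        U ⟨0, by omega⟩ =
          ((γh 1 : ℝ) : ℂ)⁻¹ *
            ((A + s • (1 : Matrix (Fin (2 * n)) (Fin (2 * n)) ℂ))⁻¹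
              ⟨0, by omega⟩ ⟨0, by omega⟩) := by
  intro s hM
  have hγ0 : ∀ k, k < n → 0 < γ (k + 1) := fun k hk => hγ _ (Finset.mem_Icc.2 (by omega))
  have hγh0 : ∀ k, k < n → 0 < γh (k + 1) := fun k hk => hγh _ (Finset.mem_Icc.2 (by omega))
  have sqrt_ne : ∀ {x : ℝ}, 0 < x → (Real.sqrt x : ℂ) ≠ 0 := fun hx =>
    Complex.ofReal_ne_zero.2 (Real.sqrt_pos.2 hx).ne'
  have inv_sqrt : ∀ {x : ℝ}, 0 < x → ((x : ℂ))⁻¹ = ((Real.sqrt x : ℂ) ^ 2)⁻¹ := fun hx => by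
    rw [← Complex.ofReal_pow, Real.sq_sqrt hx.le]
  set d : Fin (2 * n) → ℂ := fun i =>
    if i.val % 2 = 0 then (Real.sqrt (γh ((i.val + 2) / 2)) : ℂ)
    else Complex.I * (Real.sqrt (γ ((i.val + 1) / 2)) : ℂ) with hd_def
  set c : Fin (2 * n) → ℂ := fun i => (if i.val % 2 = 0 then 1 else -1) * d i with hc_def
  have hd : ∀ i, d i ≠ 0 := by
    intro i
    simp only [hd_def]
    split_ifs with hi
    · exact sqrt_ne (hγh _ (Finset.mem_Icc.2 (by omega)))
    · exact mul_ne_zero Complex.I_ne_zero (sqrt_ne (hγ _ (Finset.mem_Icc.2 (by omega))))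
  have hc : ∀ i, c i ≠ 0 := by
    intro i
    refine mul_ne_zero ?_ (hd i)
    split_ifs <;> norm_num
  have hconj : diagonal c * (T.map Complex.ofReal + s • J.map Complex.ofReal) =
      (A + s • (1 : Matrix (Fin (2 * n)) (Fin (2 * n)) ℂ)) * diagonal d := by
    ext ⟨p, hp⟩ ⟨q, hq⟩
    rw [diagonal_mul, mul_diagonal]
    simp only [Matrix.add_apply, Matrix.smul_apply, Matrix.map_apply, hT, hA, hJ,
      diagonal_apply, one_apply, hc_def, hd_def, Fin.mk.injEq, smul_eq_mul]
    by_cases hpq : p = q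
    · subst hpq
      rcases Nat.mod_two_eq_zero_or_one p with h | h
      · have h' : (p + 1) % 2 = 1 := by omega
        simp [h, h']
        ring
      · have h' : (p + 1) % 2 = 0 := by omega
        simp [h, h']
        ring
    by_cases hq1 : q = p + 1
    · subst hq1
      obtain ⟨k, rfl | rfl⟩ := Nat.even_or_odd' p
      · have e1 : (2 * k + 1) % 2 = 1 := by omega
        have e2 : (2 * k + 2) / 2 = k + 1 := by omega
        have g := hγ0 k (by omega)
        have gh := hγh0 k (by omega)
        have g' := sqrt_ne g
        have gh' := sqrt_ne gh
        simp [e1, e2, Real.sqrt_mul g.le, inv_sqrt gh]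
        field_simp
        simp
      · have e1 : (2 * k + 1 + 1) % 2 = 0 := by omega
        have e2 : (2 * k + 1 + 1 + 2) / 2 = k + 1 + 1 := by omega
        have e3 : (2 * k + 1 + 1) / 2 = k + 1 := by omega
        have e4 : (2 * k + 1) % 2 = 1 := by omega
        have g := hγ0 k (by omega)
        have gh := hγh0 (k + 1) (by omega)
        have g' := sqrt_ne g
        have gh' := sqrt_ne gh
        simp [e1, e2, e3, e4, Real.sqrt_mul g.le, inv_sqrt g]
        field_simp
    by_cases hp1 : p = q + 1
    · subst hp1
      obtain ⟨k, rfl | rfl⟩ := Nat.even_or_odd' q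
      · have e1 : (2 * k + 1) % 2 = 1 := by omega
        have e2 : (2 * k + 2) / 2 = k + 1 := by omega
        have g := hγ0 k (by omega)
        have gh := hγh0 k (by omega)
        have g' := sqrt_ne g
        have gh' := sqrt_ne gh
        simp [hq1, e1, e2, Real.sqrt_mul g.le, inv_sqrt g]
        field_simp
      · have e1 : (2 * k + 1 + 1) % 2 = 0 := by omega
        have e2 : (2 * k + 1 + 1 + 2) / 2 = k + 1 + 1 := by omega
        have e3 : (2 * k + 1 + 1) / 2 = k + 1 := by omega
        have e4 : (2 * k + 1) % 2 = 1 := by omega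
        have g := hγ0 k (by omega)
        have gh := hγh0 (k + 1) (by omega)
        have g' := sqrt_ne g
        have gh' := sqrt_ne gh
        simp [e1, e2, e3, e4, Real.sqrt_mul g.le, inv_sqrt gh]
        field_simp
        simp
    simp [hpq, hq1, hp1]
  have hB := isUnit_det_of_diagonal_mul_eq hc hconj hM
  refine ⟨hB, fun U hU => ?_⟩
  refine apply_eq_mul_inv_apply_of_diagonal_mul_eq (by simp [hc_def]) (hd _) hconj hB
    (hU.trans ?_)
  ext i
  simp [Pi.single_apply, Fin.ext_iff]
end

section
/- Let n ≥ 1, let λ₁, …, λ_n ∈ ℂ, and let Λ = −diag(λ₁, …, λ_n, conj(λ₁), …, conj(λ_n)) ∈ M_{2n}(ℂ). Let w ∈ ℂⁿ and Y₁ = (w₁, …, w_n, conj(w₁), …, conj(w_n))ᵀ ∈ ℂ^{2n} with Y₁ᵀY₁ = 1. Define α₁ = Y₁ᵀ Λ Y₁ and v₁ = Λ Y₁ − α₁ Y₁, and recursively for j ≥ 2, as long as v_{j−1}ᵀ v_{j−1} ≠ 0: choose β_j ∈ ℂ with β_j² = v_{j−1}ᵀ v_{j−1}, set Y_j = v_{j−1}/β_j,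 α_j = Y_jᵀ Λ Y_j, and v_j = Λ Y_j − α_j Y_j − β_j Y_{j−1}. Then for every j for which these quantities are defined, α_j ∈ ℝ and β_j² ∈ ℝ (and these values do not depend on the choice of square roots β_k). -/
open Matrix

/-- `Y`, `v`, `α`, `β` satisfy the complex orthogonal Lanczos recursion for `A` up to index `m`. -/
structure IsOrthogonalLanczos {ι K : Type*} [Fintype ι] [Field K] (A : Matrix ι ι K) (m : ℕ)
    (Y v : ℕ → ι → K) (α β : ℕ → K) : Prop where
  alpha_one : α 1 = Y 1 ⬝ᵥ (A *ᵥ Y 1)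
  v_one : v 1 = A *ᵥ Y 1 - α 1 • Y 1
  step : ∀ j, 2 ≤ j → j ≤ m →
    (β j) ^ 2 = v (j - 1) ⬝ᵥ v (j - 1) ∧
    Y j = (β j)⁻¹ • v (j - 1) ∧
    α j = Y j ⬝ᵥ (A *ᵥ Y j) ∧
    v j = A *ᵥ Y j - α j • Y j - β j • Y (j - 1)

namespace IsOrthogonalLanczos

variable {ι K : Type*} [Fintype ι] [Field K] {A : Matrix ι ι K} {m : ℕ}
  {Y v Y' v' : ℕ → ι → K} {α β α' β' : ℕ → K}

/-- Two runs of the recursion from the same starting vector differ only by signs of the vectors. -/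
theorem exists_sign (h : IsOrthogonalLanczos A m Y v α β) (h' : IsOrthogonalLanczos A m Y' v' α' β')
    (h1 : Y' 1 = Y 1) {j : ℕ} (hj : 1 ≤ j) (hjm : j ≤ m) :
    α' j = α j ∧ ∃ s : K, s ^ 2 = 1 ∧ Y' j = s • Y j ∧ v' j = s • v j := by
  induction j, hj using Nat.le_induction with
  | base =>
    have hα : α' 1 = α 1 := by rw [h'.alpha_one, h.alpha_one, h1]
    exact ⟨hα, 1, by simp, by simp [h1], by rw [h'.v_one, h.v_one, h1, hα, one_smul]⟩
  | succ k hk ih =>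
    obtain ⟨-, s, hs, hY, hv⟩ := ih (by omega)
    obtain ⟨hb, hYs, hα, hvs⟩ := h.step (k + 1) (by omega) hjm
    obtain ⟨hb', hYs', hα', hvs'⟩ := h'.step (k + 1) (by omega) hjm
    simp only [Nat.add_sub_cancel] at *
    obtain ⟨t, ht, htβ⟩ : ∃ t : K, t ^ 2 = 1 ∧ β' (k + 1) = t * β (k + 1) := by
      have hsq : β' (k + 1) ^ 2 = β (k + 1) ^ 2 := by
        rw [hb', hb, hv, smul_dotProduct, dotProduct_smul, smul_smul, ← sq, hs, one_smul]
      rcases sq_eq_sq_iff_eq_or_eq_neg.1 hsq with e | e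
      · exact ⟨1, by simp, by simp [e]⟩
      · exact ⟨-1, by simp, by simp [e]⟩
    have ht_inv : t⁻¹ = t := inv_eq_of_mul_eq_one_left (by rw [← sq, ht])
    have hYn : Y' (k + 1) = (t * s) • Y (k + 1) := by
      rw [hYs', hYs, hv, htβ, mul_inv, ht_inv, smul_smul, smul_smul]
      congr 1
      ring
    have hts : (t * s) ^ 2 = 1 := by rw [mul_pow, ht, hs, one_mul]
    have hαn : α' (k + 1) = α (k + 1) := by
      rw [hα', hα, hYn, mulVec_smul, smul_dotProduct, dotProduct_smul, smul_smul, ← sq, hts,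
        one_smul]
    refine ⟨hαn, t * s, hts, hYn, ?_⟩
    rw [hvs', hvs, hαn, hYn, hY, htβ, mulVec_smul]
    module

theorem alpha_eq (h : IsOrthogonalLanczos A m Y v α β) (h' : IsOrthogonalLanczos A m Y' v' α' β')
    (h1 : Y' 1 = Y 1) {j : ℕ} (hj : 1 ≤ j) (hjm : j ≤ m) : α' j = α j :=
  (h.exists_sign h' h1 hj hjm).1

theorem beta_sq_eq (h : IsOrthogonalLanczos A m Y v α β) (h' : IsOrthogonalLanczos A m Y' v' α' β')
    (h1 : Y' 1 = Y 1) {j : ℕ} (hj : 2 ≤ j) (hjm : j ≤ m) : β' j ^ 2 = β j ^ 2 := by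
  obtain ⟨-, s, hs, -, hv⟩ := h.exists_sign h' h1 (j := j - 1) (by omega) (by omega)
  rw [(h.step j hj hjm).1, (h'.step j hj hjm).1, hv, smul_dotProduct, dotProduct_smul, smul_smul,
    ← sq, hs, one_smul]

/-- A permutation of the indices combined with a field endomorphism maps runs of the recursion
to runs of the recursion, if it fixes the matrix. -/
theorem map (h : IsOrthogonalLanczos A m Y v α β) (e : ι ≃ ι) (f : K →+* K)
    (hA : ∀ i k, f (A (e i) (e k)) = A i k) :
    IsOrthogonalLanczos A m (fun j i => f (Y j (e i))) (fun j i => f (v j (e i)))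
      (fun j => f (α j)) (fun j => f (β j)) := by
  have hdot (x y : ι → K) :
      f (x ⬝ᵥ y) = (fun i => f (x (e i))) ⬝ᵥ (fun i => f (y (e i))) := by
    simp only [dotProduct, map_sum, map_mul]
    exact (e.sum_comp fun i => f (x i) * f (y i)).symm
  have hmul (x : ι → K) :
      A *ᵥ (fun i => f (x (e i))) = fun i => f ((A *ᵥ x) (e i)) := by
    ext i
    simp only [mulVec, hdot, hA]
  refine ⟨?_, ?_, fun j hj hjm => ?_⟩
  · rw [hmul, ← hdot, h.alpha_one]
  · rw [hmul, h.v_one]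
    ext i
    simp
  · obtain ⟨hb, hY, hα, hv⟩ := h.step j hj hjm
    refine ⟨?_, ?_, ?_, ?_⟩
    · rw [← hdot, ← hb, map_pow]
    · rw [hY]
      ext i
      simp
    · rw [hmul, ← hdot, hα]
    · rw [hmul, hv]
      ext i
      simp

end IsOrthogonalLanczos

/- STATEMENT 11: in the J-symmetric Lanczos recursion applied to
   Λ = −diag(λ, conj λ) started from Y₁ = (w, conj w) with Y₁ᵀY₁ = 1, all coefficients
   α_j are real, all β_j² are real, and α_j, β_j² do not depend on the choice of the
   square roots β_k. (Indices Fin n ⊕ Fin n encode the block structure (1..n, conj).) -/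
theorem stmt11 (n : ℕ) (hn : 1 ≤ n) (lam w : Fin n → ℂ)
    (Λ : Matrix (Fin n ⊕ Fin n) (Fin n ⊕ Fin n) ℂ)
    (hΛ : Λ = Matrix.diagonal (Sum.elim (fun i => -lam i)
      (fun i => -(starRingEnd ℂ) (lam i))))
    (m : ℕ)
    (Y v : ℕ → (Fin n ⊕ Fin n) → ℂ) (α β : ℕ → ℂ)
    (hY1 : Y 1 = Sum.elim w (fun i => (starRingEnd ℂ) (w i)))
    (hnorm : Y 1 ⬝ᵥ Y 1 = 1)
    (hα1 : α 1 = Y 1 ⬝ᵥ (Λ *ᵥ Y 1))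
    (hv1 : v 1 = Λ *ᵥ Y 1 - α 1 • Y 1)
    (hrec : ∀ j, 2 ≤ j → j ≤ m →
      v (j - 1) ⬝ᵥ v (j - 1) ≠ 0 ∧
      (β j) ^ 2 = v (j - 1) ⬝ᵥ v (j - 1) ∧
      Y j = (β j)⁻¹ • v (j - 1) ∧
      α j = Y j ⬝ᵥ (Λ *ᵥ Y j) ∧
      v j = Λ *ᵥ Y j - α j • Y j - β j • Y (j - 1)) :
    (∀ j, 1 ≤ j → j ≤ m → (α j).im = 0) ∧
    (∀ j, 2 ≤ j → j ≤ m → ((β j) ^ 2).im = 0) ∧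
    (∀ (Y' v' : ℕ → (Fin n ⊕ Fin n) → ℂ) (α' β' : ℕ → ℂ),
      Y' 1 = Y 1 →
      α' 1 = Y' 1 ⬝ᵥ (Λ *ᵥ Y' 1) →
      v' 1 = Λ *ᵥ Y' 1 - α' 1 • Y' 1 →
      (∀ j, 2 ≤ j → j ≤ m →
        v' (j - 1) ⬝ᵥ v' (j - 1) ≠ 0 ∧
        (β' j) ^ 2 = v' (j - 1) ⬝ᵥ v' (j - 1) ∧
        Y' j = (β' j)⁻¹ • v' (j - 1) ∧
        α' j = Y' j ⬝ᵥ (Λ *ᵥ Y' j) ∧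
        v' j = Λ *ᵥ Y' j - α' j • Y' j - β' j • Y' (j - 1)) →
      (∀ j, 1 ≤ j → j ≤ m → α' j = α j) ∧
      (∀ j, 2 ≤ j → j ≤ m → (β' j) ^ 2 = (β j) ^ 2)) := by
  have h : IsOrthogonalLanczos Λ m Y v α β :=
    ⟨hα1, hv1, fun j hj hjm => (hrec j hj hjm).2⟩
  have hconj := h.map (Equiv.sumComm (Fin n) (Fin n)) (starRingEnd ℂ) (by
    subst hΛ
    rintro (i | i) (k | k) <;> simp [diagonal_apply, apply_ite (starRingEnd ℂ)])
  have hstart : (fun i => (starRingEnd ℂ) (Y 1 (Equiv.sumComm (Fin n) (Fin n) i))) = Y 1 := by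
    rw [hY1]
    ext (i | i) <;> simp
  refine ⟨fun j hj hjm => ?_, fun j hj hjm => ?_, fun Y' v' α' β' hY' hα' hv' hrec' => ?_⟩
  · exact Complex.conj_eq_iff_im.1 (h.alpha_eq hconj hstart hj hjm)
  · exact Complex.conj_eq_iff_im.1 (by rw [map_pow]; exact h.beta_sq_eq hconj hstart hj hjm)
  · have h' : IsOrthogonalLanczos Λ m Y' v' α' β' :=
      ⟨hα', hv', fun j hj hjm => (hrec' j hj hjm).2⟩
    exact ⟨fun j => h.alpha_eq h' hY', fun j => h.beta_sq_eq h' hY'⟩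
end

section
/- Let n ≥ 1, let r₀ ≥ 0, let 0 < θ₁ < θ₂ < … < θ_n be reals with θ₁ > r₀/2, and let ξ₁, …, ξ_n > 0. Define λ_j = −r₀/2 + i·√(θ_j² − r₀²/4) and y_j = ξ_j·λ_j/(λ_j − conj(λ_j)) for j = 1, …, n, and set γ̂₁ = (ξ₁ + … + ξ_n)^{-1}. Then there exist positive reals γ₁, …, γ_n and γ̂₂, …, γ̂_n such that for every s ∈ ℂ with s·(s + r₀) ≠ −θ_j² for all j, the linear system (û_j − û_{j−1})/γ̂_j + (s + r₀)·u_j = 0 (j = 1, …, n), (u_{j+1} − u_j)/γ_j + s·û_j = 0 (j = 1, …, n), û₀ = 1, u_{n+1} = 0, has a unique solution (u₁, …, u_{n+1}, û₀, …, û_n) ∈ ℂ^{2n+2}, and its first component satisfies u₁ = Σ_{j=1}^n [ y_j/(s − λ_j) + conj(y_j)/(s − conj(λ_j)) ]. -/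
open Polynomial in
/-- A polynomial of degree at most `j` is a multiple of a polynomial of exact degree `j` plus a
remainder of smaller degree. -/
theorem exists_eq_C_mul_add_degree_lt {p q : ℝ[X]} {j : ℕ} (hp : p.degree = j)
    (hq : q.degree < (j + 1 : ℕ)) : ∃ (c : ℝ) (t : ℝ[X]), t.degree < j ∧ q = C c * p + t := by
  have hc : p.coeff j ≠ 0 := coeff_ne_zero_of_eq_degree hp
  refine ⟨q.coeff j / p.coeff j, q - C (q.coeff j / p.coeff j) * p, ?_, by ring⟩
  rw [degree_lt_iff_coeff_zero] at hq ⊢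
  intro m hm
  rcases hm.eq_or_lt with rfl | hm
  · simp [hc]
  · simp [hq m hm, coeff_eq_zero_of_degree_lt (hp.trans_lt (by exact_mod_cast hm) : p.degree < m)]

open Polynomial in
/-- One step of the coupled recursion: `p` is orthogonal to polynomials of degree `< j` and
normalised by `p(0) = 1`, and `v` is the reproducing kernel at `0` for degree `< j`. -/
theorem stieltjes_step (L : ℝ[X] →ₗ[ℝ] ℝ) {j : ℕ} {p v : ℝ[X]}
    (hpos : ∀ f : ℝ[X], f.degree = j → 0 < L (f * f) ∧ 0 < L (X * f * f))
    (hp : p.degree = j) (hv : v.degree < j) (hp0 : p.eval 0 = 1)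
    (hpL : ∀ q : ℝ[X], q.degree < j → L (p * q) = 0)
    (hvL : ∀ q : ℝ[X], q.degree < j → L (v * q) = q.eval 0)
    {b c : ℝ} {v' p' : ℝ[X]} (hb : b = (L (p * p))⁻¹) (hv' : v' = v + C b * p)
    (hc : c = (L (X * v' * v'))⁻¹) (hp' : p' = p - C c * (X * v')) :
    0 < b ∧ 0 < c ∧ p'.degree = ((j + 1 : ℕ) : WithBot ℕ) ∧ v'.degree < (j + 1 : ℕ) ∧ p'.eval 0 = 1 ∧
      (∀ q : ℝ[X], q.degree < (j + 1 : ℕ) → L (p' * q) = 0) ∧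
      (∀ q : ℝ[X], q.degree < (j + 1 : ℕ) → L (v' * q) = q.eval 0) := by
  have hL : ∀ (r : ℝ) (f : ℝ[X]), L (C r * f) = r * L f := fun r f => by
    rw [← smul_eq_C_mul, map_smul, smul_eq_mul]
  have hpp := (hpos p hp).1
  have hb0 : 0 < b := hb ▸ inv_pos.2 hpp
  have hbp : b * L (p * p) = 1 := by rw [hb, inv_mul_cancel₀ hpp.ne']
  have hdv : v'.degree = j := by
    rw [hv', degree_add_eq_right_of_degree_lt] <;> rw [degree_C_mul hb0.ne', hp]
    exact hv
  have hvv := (hpos v' hdv).2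
  have hc0 : 0 < c := hc ▸ inv_pos.2 hvv
  have hcv : c * L (X * v' * v') = 1 := by rw [hc, inv_mul_cancel₀ hvv.ne']
  have hdX : (C c * (X * v')).degree = ((j + 1 : ℕ) : WithBot ℕ) := by
    rw [degree_C_mul hc0.ne', mul_comm, degree_mul_X, hdv]; norm_cast
  have hlt : (j : WithBot ℕ) < (j + 1 : ℕ) := by exact_mod_cast Nat.lt_succ_self j
  have hv'L : ∀ q : ℝ[X], q.degree < (j + 1 : ℕ) → L (v' * q) = q.eval 0 := by
    intro q hq
    obtain ⟨r, t, ht, rfl⟩ := exists_eq_C_mul_add_degree_lt hp hq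
    have e : v' * (C r * p + t)
        = C r * (p * v) + C r * (C b * (p * p)) + v * t + C b * (p * t) := by
      rw [hv']; ring
    rw [e]
    simp only [map_add, hL, hpL v hv, hpL t ht, hvL t ht, hbp]
    simp [hp0]
  refine ⟨hb0, hc0, ?_, hdv.trans_lt hlt, ?_, ?_, hv'L⟩
  · rw [hp', degree_sub_eq_right_of_degree_lt, hdX]
    rw [hdX, hp]; exact hlt
  · simp [hp', hp0]
  · intro q hq
    obtain ⟨r, t, ht, rfl⟩ := exists_eq_C_mul_add_degree_lt hdv hq
    have hpv : L (p * v') = 1 := by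
      have e : p * v' = p * v + C b * (p * p) := by rw [hv']; ring
      rw [e, map_add, hL, hpL v hv, hbp, zero_add]
    have hXt : L (v' * (X * t)) = 0 := by
      rw [hv'L]
      · simp
      · by_cases h0 : t = 0
        · simp [h0]
        · rw [mul_comm, degree_mul_X]
          rw [degree_eq_natDegree h0] at ht ⊢
          norm_cast at ht ⊢
          omega
    have e : p' * (C r * v' + t) = C r * (p * v') + p * t
        - (C r * (C c * (X * v' * v')) + C c * (v' * (X * t))) := by
      rw [hp']; ring
    rw [e]
    simp only [map_sub, map_add, hL, hpv, hpL t ht, hcv, hXt]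
    ring

open Polynomial in
/-- The coefficients of the Stieltjes continued fraction attached to a functional that is positive
on squares of polynomials of degree `< n`, for both the functional and its multiple by `X`. -/
theorem exists_stieltjes_recursion (L : ℝ[X] →ₗ[ℝ] ℝ) (n : ℕ)
    (hpos : ∀ f : ℝ[X], f ≠ 0 → f.degree < n → 0 < L (f * f) ∧ 0 < L (X * f * f)) :
    ∃ (p v : ℕ → ℝ[X]) (c b : ℕ → ℝ), p 0 = 1 ∧ v 0 = 0 ∧ b 0 = (L 1)⁻¹ ∧
      (∀ j, v (j + 1) = v j + C (b j) * p j) ∧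
      (∀ j, p (j + 1) = p j - C (c j) * (X * v (j + 1))) ∧
      (∀ j < n, 0 < c j ∧ 0 < b j) ∧
      (∀ j ≤ n, ∀ q : ℝ[X], q.degree < j → L (p j * q) = 0) := by
  let B : ℝ[X] × ℝ[X] → ℝ := fun x => (L (x.1 * x.1))⁻¹
  let V : ℝ[X] × ℝ[X] → ℝ[X] := fun x => x.2 + C (B x) * x.1
  let G : ℝ[X] × ℝ[X] → ℝ := fun x => (L (X * V x * V x))⁻¹
  let x : ℕ → ℝ[X] × ℝ[X] :=
    fun j => Nat.rec (1, 0) (fun _ y => (y.1 - C (G y) * (X * V y), V y)) j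
  have hstep : ∀ j < n, ∀ f : ℝ[X], f.degree = j →
      0 < L (f * f) ∧ 0 < L (X * f * f) := by
    intro j hj f hf
    refine hpos f ?_ (hf.trans_lt (by exact_mod_cast hj))
    rintro rfl
    simp at hf
  have inv : ∀ j ≤ n, (x j).1.degree = j ∧ (x j).2.degree < j ∧ (x j).1.eval 0 = 1 ∧
      (∀ q : ℝ[X], q.degree < j → L ((x j).1 * q) = 0) ∧
      (∀ q : ℝ[X], q.degree < j → L ((x j).2 * q) = q.eval 0) := by
    intro j
    induction j with
    | zero =>
      intro _
      have hz : ∀ q : ℝ[X], q.degree < (0 : ℕ) → q = 0 := fun q hq => by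
        simpa [Polynomial.degree_lt_iff_coeff_zero, Polynomial.ext_iff] using hq
      refine ⟨by simp [x], by simp [x], by simp [x], ?_, ?_⟩
      · intro q hq; simp [hz q hq]
      · intro q hq; simp [hz q hq]
    | succ j ih =>
      intro hj
      obtain ⟨h1, h2, h3, h4, h5⟩ := ih (by omega)
      exact (stieltjes_step L (hstep j (by omega)) h1 h2 h3 h4 h5 (b := B (x j))
        (c := G (x j)) rfl rfl rfl rfl).2.2
  refine ⟨fun j => (x j).1, fun j => (x j).2, fun j => G (x j), fun j => B (x j), rfl, rfl,
    by simp [B, x], fun j => rfl, fun j => rfl, ?_, fun j hj => (inv j hj).2.2.2.1⟩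
  intro j hj
  obtain ⟨h1, h2, h3, h4, h5⟩ := inv j hj.le
  have h := stieltjes_step L (hstep j hj) h1 h2 h3 h4 h5 (b := B (x j))
    (c := G (x j)) rfl rfl rfl rfl
  exact ⟨h.2.1, h.1⟩

open Polynomial in
/-- The recursion for a discrete measure with masses `ξ` at distinct positive nodes `a`;
it terminates with a polynomial vanishing at all the nodes. -/
theorem exists_stieltjes_recursion_of_nodes (n : ℕ) (hn : 1 ≤ n) (a ξ : ℕ → ℝ)
    (ha : ∀ j ∈ Finset.Icc 1 n, 0 < a j) (hinj : Set.InjOn a (Finset.Icc 1 n))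
    (hξ : ∀ j ∈ Finset.Icc 1 n, 0 < ξ j) :
    ∃ (P V : ℕ → ℕ → ℝ) (c b : ℕ → ℝ), (∀ k, P 0 k = 1) ∧ (∀ k, V 0 k = 0) ∧
      b 0 = (∑ k ∈ Finset.Icc 1 n, ξ k)⁻¹ ∧
      (∀ j k, V (j + 1) k = V j k + b j * P j k) ∧
      (∀ j k, P (j + 1) k = P j k - c j * (a k * V (j + 1) k)) ∧
      (∀ j < n, 0 < c j ∧ 0 < b j) ∧
      (∀ j, 1 ≤ j → j ≤ n → ∑ k ∈ Finset.Icc 1 n, ξ k * P j k = 0) ∧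
      (∀ k ∈ Finset.Icc 1 n, P n k = 0) := by
  let L : ℝ[X] →ₗ[ℝ] ℝ := ∑ k ∈ Finset.Icc 1 n, ξ k • Polynomial.leval (a k)
  have hL : ∀ f, L f = ∑ k ∈ Finset.Icc 1 n, ξ k * f.eval (a k) := fun f => by
    simp [L, LinearMap.sum_apply]
  have hpos : ∀ f : ℝ[X], f ≠ 0 → f.degree < n → 0 < L (f * f) ∧ 0 < L (X * f * f) := by
    intro f hf hdeg
    obtain ⟨k, hk, hfk⟩ : ∃ k ∈ Finset.Icc 1 n, f.eval (a k) ≠ 0 := by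
      by_contra! h
      refine hf (eq_zero_of_degree_lt_of_eval_index_eq_zero _ hinj ?_ h)
      simpa using hdeg
    rw [hL, hL]
    constructor
    · refine Finset.sum_pos' (fun i hi => ?_) ⟨k, hk, ?_⟩
      · have := hξ i hi
        rw [eval_mul]
        exact mul_nonneg this.le (mul_self_nonneg _)
      · have := hξ k hk
        rw [eval_mul]
        exact mul_pos this (mul_self_pos.2 hfk)
    · refine Finset.sum_pos' (fun i hi => ?_) ⟨k, hk, ?_⟩
      · rw [eval_mul, eval_mul, eval_X, mul_assoc]
        exact mul_nonneg (hξ i hi).le (mul_nonneg (ha i hi).le (mul_self_nonneg _))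
      · rw [eval_mul, eval_mul, eval_X, mul_assoc]
        exact mul_pos (hξ k hk) (mul_pos (ha k hk) (mul_self_pos.2 hfk))
  obtain ⟨p, v, c, b, hp0, hv0, hb0, hv, hp, hcb, horth⟩ := exists_stieltjes_recursion L n hpos
  refine ⟨fun j k => (p j).eval (a k), fun j k => (v j).eval (a k), c, b, by simp [hp0],
    by simp [hv0], by simp [hb0, hL], fun j k => by simp [hv], ?_, hcb, ?_, ?_⟩
  · intro j k
    simp [hp j]
  · intro j h1 hj
    have h := horth j hj 1 (by rw [degree_one]; exact_mod_cast h1)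
    simpa [hL] using h
  · intro k hk
    let q : ℝ[X] := ∏ i ∈ (Finset.Icc 1 n).erase k, (X - C (a i))
    have hq : q.degree < n := by
      rw [degree_prod]
      simp only [degree_X_sub_C, Finset.sum_const, Finset.card_erase_of_mem hk, Nat.card_Icc]
      simp only [nsmul_eq_mul, mul_one]
      exact_mod_cast (by omega : n + 1 - 1 - 1 < n)
    have h := horth n le_rfl q hq
    rw [hL, Finset.sum_eq_single k] at h
    · have hqk : q.eval (a k) ≠ 0 := by
        simp only [q, eval_prod, eval_sub, eval_X, eval_C]
        refine Finset.prod_ne_zero_iff.2 fun i hi => sub_ne_zero.2 fun e => ?_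
        exact (Finset.ne_of_mem_erase hi) (hinj (Finset.mem_of_mem_erase hi) hk e.symm)
      simpa [hqk, (hξ k hk).ne'] using h
    · intro i hi hik
      have : q.eval (a i) = 0 := by
        simp only [q, eval_prod, eval_sub, eval_X, eval_C]
        exact Finset.prod_eq_zero (Finset.mem_erase.2 ⟨hik, hi⟩) (sub_self _)
      simp [this]
    · exact fun hk' => absurd hk hk'

/-- A homogeneous solution of the staggered system vanishes as soon as the system is solvable with
unit boundary value: the discrete Wronskian of the two is constant. -/
theorem staggered_homogeneous_eq_zero {n : ℕ} {c b : ℕ → ℂ} {s z : ℂ} {u w d e : ℕ → ℂ}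
    (hu : ∀ j ∈ Finset.Icc 1 n, w j = w (j - 1) - b j * (z * u j) ∧
      u (j + 1) = u j - c j * (s * w j))
    (hw0 : w 0 = 1) (hun : u (n + 1) = 0)
    (hd : ∀ j ∈ Finset.Icc 1 n, e j = e (j - 1) - b j * (z * d j) ∧
      d (j + 1) = d j - c j * (s * e j))
    (he0 : e 0 = 0) (hdn : d (n + 1) = 0) :
    ∀ j ≤ n, d (j + 1) = 0 ∧ e j = 0 := by
  have hW : ∀ j ≤ n, u (j + 1) * e j - d (j + 1) * w j = u 1 * e 0 - d 1 * w 0 := by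
    intro j
    induction j with
    | zero => intro _; rfl
    | succ j ih =>
      intro hj
      have hmem : j + 1 ∈ Finset.Icc 1 n := Finset.mem_Icc.2 ⟨by omega, hj⟩
      obtain ⟨h1, h2⟩ := hu _ hmem
      obtain ⟨h3, h4⟩ := hd _ hmem
      rw [Nat.add_sub_cancel] at h1 h3
      rw [← ih (by omega), h2, h4, h1, h3]
      ring
  have hd1 : d 1 = 0 := by
    have h := hW n le_rfl
    rw [hun, hdn, hw0, he0] at h
    linear_combination h
  intro j
  induction j with
  | zero => exact fun _ => ⟨hd1, he0⟩
  | succ j ih =>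
    intro hj
    obtain ⟨h1, h2⟩ := ih (by omega)
    obtain ⟨h3, h4⟩ := hd (j + 1) (Finset.mem_Icc.2 ⟨by omega, hj⟩)
    rw [Nat.add_sub_cancel, h1, h2] at h3
    have h5 : e (j + 1) = 0 := by rw [h3]; ring
    exact ⟨by rw [h4, h1, h5]; ring, h5⟩

/-- A conjugate pair of poles with the given residues combines to a single real fraction. -/
theorem conj_pole_pair_eq {r0 θ ξ : ℝ} (hr0 : 0 ≤ r0) (hθ : r0 / 2 < θ) {l y s : ℂ}
    (hl : l = -(r0 / 2 : ℂ) + Complex.I * (Real.sqrt (θ ^ 2 - r0 ^ 2 / 4) : ℂ))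
    (hy : y = (ξ : ℂ) * l / (l - (starRingEnd ℂ) l))
    (hs : s * (s + (r0 : ℂ)) ≠ -(θ : ℂ) ^ 2) :
    y / (s - l) + (starRingEnd ℂ) y / (s - (starRingEnd ℂ) l)
      = s * (ξ / (s * (s + r0) + θ ^ 2)) := by
  have hpos : 0 < θ ^ 2 - r0 ^ 2 / 4 := by nlinarith
  set t := Real.sqrt (θ ^ 2 - r0 ^ 2 / 4) with ht
  have ht0 : (t : ℂ) ≠ 0 := by exact_mod_cast (Real.sqrt_pos.2 hpos).ne'
  have ht2 : (t : ℂ) ^ 2 = θ ^ 2 - r0 ^ 2 / 4 := by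
    rw [ht]; exact_mod_cast Real.sq_sqrt hpos.le
  set m := (starRingEnd ℂ) l with hm
  have hm' : m = -(r0 / 2 : ℂ) - Complex.I * t := by
    rw [hm, hl]
    simp [sub_eq_add_neg, Complex.conj_ofNat]
  have hyc : (starRingEnd ℂ) y = (ξ : ℂ) * m / (m - l) := by
    rw [hy]
    simp [hm]
  have hlm : l - m ≠ 0 := by
    have : l - m = 2 * Complex.I * t := by rw [hl, hm']; ring
    rw [this]
    exact mul_ne_zero (mul_ne_zero two_ne_zero Complex.I_ne_zero) ht0
  have hml : m - l ≠ 0 := by rwa [← neg_sub, neg_ne_zero]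
  have hfac : (s - l) * (s - m) = s * (s + r0) + θ ^ 2 := by
    rw [hl, hm']
    linear_combination ht2 - (t : ℂ) ^ 2 * Complex.I_sq
  have hz : s * (s + r0) + (θ : ℂ) ^ 2 ≠ 0 := fun h => hs (eq_neg_of_add_eq_zero_left h)
  rw [← hfac] at hz ⊢
  have h1 := left_ne_zero_of_mul hz
  have h2 := right_ne_zero_of_mul hz
  have hyc' : (starRingEnd ℂ) y = -((ξ : ℂ) * m / (l - m)) := by
    rw [hyc, ← neg_sub l m, div_neg]
  rw [hyc', hy]
  field_simp
  ring

/- STATEMENT 14 (Proposition 1): for constant loss r₀, there exist positive ROM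
   coefficients γ_j, γ̂_j (with γ̂₁ = (ξ₁+…+ξ_n)⁻¹) such that the staggered finite
   difference system with primary loss r₀ and zero dual loss has a unique solution
   whose first component matches the truncated spectral measure transfer function. -/
theorem stmt14 (n : ℕ) (hn : 1 ≤ n) (r0 : ℝ) (hr0 : 0 ≤ r0)
    (θ ξ : ℕ → ℝ)
    (hθ1 : r0 / 2 < θ 1)
    (hθpos : ∀ j ∈ Finset.Icc 1 n, 0 < θ j)
    (hθmono : ∀ j, 1 ≤ j → j < n → θ j < θ (j + 1))
    (hξ : ∀ j ∈ Finset.Icc 1 n, 0 < ξ j)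
    (lam y : ℕ → ℂ)
    (hlam : ∀ j, lam j =
      -(r0 / 2 : ℂ) + Complex.I * (Real.sqrt ((θ j) ^ 2 - r0 ^ 2 / 4) : ℂ))
    (hy : ∀ j, y j = (ξ j : ℂ) * lam j / (lam j - (starRingEnd ℂ) (lam j))) :
    ∃ γ γh : ℕ → ℝ,
      γh 1 = (∑ j ∈ Finset.Icc 1 n, ξ j)⁻¹ ∧
      (∀ j ∈ Finset.Icc 1 n, 0 < γ j) ∧
      (∀ j ∈ Finset.Icc 1 n, 0 < γh j) ∧
      ∀ s : ℂ, (∀ j ∈ Finset.Icc 1 n, s * (s + (r0 : ℂ)) ≠ -(θ j : ℂ) ^ 2) →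
        (∃ u uh : ℕ → ℂ,
          (∀ j ∈ Finset.Icc 1 n,
            (uh j - uh (j - 1)) / (γh j : ℂ) + (s + (r0 : ℂ)) * u j = 0 ∧
            (u (j + 1) - u j) / (γ j : ℂ) + s * uh j = 0) ∧
          uh 0 = 1 ∧ u (n + 1) = 0 ∧
          u 1 = ∑ j ∈ Finset.Icc 1 n,
            (y j / (s - lam j) +
              (starRingEnd ℂ) (y j) / (s - (starRingEnd ℂ) (lam j)))) ∧
        (∀ u uh u₂ uh₂ : ℕ → ℂ,
          (∀ j ∈ Finset.Icc 1 n,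
            (uh j - uh (j - 1)) / (γh j : ℂ) + (s + (r0 : ℂ)) * u j = 0 ∧
            (u (j + 1) - u j) / (γ j : ℂ) + s * uh j = 0) →
          uh 0 = 1 → u (n + 1) = 0 →
          (∀ j ∈ Finset.Icc 1 n,
            (uh₂ j - uh₂ (j - 1)) / (γh j : ℂ) + (s + (r0 : ℂ)) * u₂ j = 0 ∧
            (u₂ (j + 1) - u₂ j) / (γ j : ℂ) + s * uh₂ j = 0) →
          uh₂ 0 = 1 → u₂ (n + 1) = 0 →
          (∀ j ∈ Finset.Icc 1 (n + 1), u j = u₂ j) ∧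
          (∀ j ∈ Finset.Icc 0 n, uh j = uh₂ j)) := by
  have hmono : StrictMonoOn θ (Set.Icc 1 n) := by
    refine strictMonoOn_of_lt_add_one Set.ordConnected_Icc fun j _ h1 h2 => ?_
    exact hθmono j h1.1 (by have := h2.2; omega)
  have hθlb : ∀ j ∈ Finset.Icc 1 n, r0 / 2 < θ j := by
    intro j hj
    have hj' := Finset.mem_Icc.1 hj
    exact hθ1.trans_le (hmono.monotoneOn ⟨le_rfl, hn⟩ hj' hj'.1)
  obtain ⟨P, V, c, b, hP0, hV0, hb0, hV, hP, hcb, horth, hPn⟩ :=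
    exists_stieltjes_recursion_of_nodes n hn (fun j => θ j ^ 2) ξ
      (fun j hj => pow_pos (hθpos j hj) 2)
      (by
        intro i hi j hj h
        refine hmono.injOn (Finset.mem_Icc.1 hi) (Finset.mem_Icc.1 hj) ?_
        exact (pow_left_inj₀ (hθpos i hi).le (hθpos j hj).le two_ne_zero).1 h) hξ
  have hcpos : ∀ j ∈ Finset.Icc 1 n, 0 < c (j - 1) := fun j hj =>
    (hcb (j - 1) (by have := Finset.mem_Icc.1 hj; omega)).1
  have hbpos : ∀ j ∈ Finset.Icc 1 n, 0 < b (j - 1) := fun j hj =>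
    (hcb (j - 1) (by have := Finset.mem_Icc.1 hj; omega)).2
  refine ⟨fun j => c (j - 1), fun j => b (j - 1), hb0, hcpos, hbpos, fun s hs => ?_⟩
  have hz : ∀ k ∈ Finset.Icc 1 n, s * (s + r0) + (θ k : ℂ) ^ 2 ≠ 0 := fun k hk h =>
    hs k hk (eq_neg_of_add_eq_zero_left h)
  have hsys : ∀ u w : ℕ → ℂ, (∀ j ∈ Finset.Icc 1 n,
      (w j - w (j - 1)) / (b (j - 1) : ℂ) + (s + (r0 : ℂ)) * u j = 0 ∧
      (u (j + 1) - u j) / (c (j - 1) : ℂ) + s * w j = 0) ↔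
      ∀ j ∈ Finset.Icc 1 n, w j = w (j - 1) - (b (j - 1) : ℂ) * ((s + r0) * u j) ∧
        u (j + 1) = u j - (c (j - 1) : ℂ) * (s * w j) := by
    intro u w
    refine forall₂_congr fun j hj => ?_
    have h1 : (b (j - 1) : ℂ) ≠ 0 := by exact_mod_cast (hbpos j hj).ne'
    have h2 : (c (j - 1) : ℂ) ≠ 0 := by exact_mod_cast (hcpos j hj).ne'
    refine and_congr ?_ ?_
    · rw [div_add' _ _ _ h1, div_eq_zero_iff, or_iff_left h1]
      constructor <;> intro h <;> linear_combination h
    · rw [div_add' _ _ _ h2, div_eq_zero_iff, or_iff_left h2]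
      constructor <;> intro h <;> linear_combination h
  let u : ℕ → ℂ := fun j =>
    s * ∑ k ∈ Finset.Icc 1 n, ξ k * P (j - 1) k / (s * (s + r0) + (θ k : ℂ) ^ 2)
  let w' : ℕ → ℂ := fun j =>
    ∑ k ∈ Finset.Icc 1 n, ξ k * ((θ k : ℂ) ^ 2 * V j k) / (s * (s + r0) + (θ k : ℂ) ^ 2)
  let w : ℕ → ℂ := fun j => if j = 0 then 1 else w' j
  have hw0 : w 0 = 1 := rfl
  have hun : u (n + 1) = 0 := by
    simp only [u, Nat.add_sub_cancel]
    rw [Finset.sum_eq_zero, mul_zero]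
    intro k hk
    simp [hPn k hk]
  have hw'step : ∀ j, w' (j + 1) = w' j - b j * ((s + r0) * u (j + 1))
      + b j * ∑ k ∈ Finset.Icc 1 n, (ξ k * P j k : ℂ) := by
    intro j
    simp only [u, w', Nat.add_sub_cancel, Finset.mul_sum]
    rw [← Finset.sum_sub_distrib, ← Finset.sum_add_distrib]
    refine Finset.sum_congr rfl fun k hk => ?_
    have := hz k hk
    rw [hV]
    push_cast
    field_simp
    ring
  have hu : ∀ j ∈ Finset.Icc 1 n, w j = w (j - 1) - (b (j - 1) : ℂ) * ((s + r0) * u j) ∧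
        u (j + 1) = u j - (c (j - 1) : ℂ) * (s * w j) := by
    intro j hj
    obtain ⟨j, rfl⟩ : ∃ i, j = i + 1 := ⟨j - 1, by have := Finset.mem_Icc.1 hj; omega⟩
    have hwj : w (j + 1) = w' (j + 1) := rfl
    rw [Nat.add_sub_cancel, hwj]
    constructor
    · rw [hw'step]
      rcases Nat.eq_zero_or_pos j with rfl | hj0
      · have hw'0 : w' 0 = 0 := by simp [w', hV0]
        have hsum : (b 0 : ℂ) * ∑ k ∈ Finset.Icc 1 n, (ξ k * P 0 k : ℂ) = 1 := by
          have h : 0 < ∑ k ∈ Finset.Icc 1 n, ξ k :=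
            Finset.sum_pos hξ ⟨1, Finset.mem_Icc.2 ⟨le_rfl, hn⟩⟩
          simp only [hP0, hb0, Complex.ofReal_one, mul_one]
          exact_mod_cast inv_mul_cancel₀ h.ne'
        rw [hw'0, hw0, hsum]
        ring
      · have h0 : ∑ k ∈ Finset.Icc 1 n, (ξ k * P j k : ℂ) = 0 := by
          exact_mod_cast horth j hj0 (by have := (Finset.mem_Icc.1 hj).2; omega)
        have hwj' : w j = w' j := if_neg hj0.ne'
        rw [h0, hwj', mul_zero, add_zero]
    · simp only [u, w', Nat.add_sub_cancel, Finset.mul_sum]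
      rw [← Finset.sum_sub_distrib]
      refine Finset.sum_congr rfl fun k hk => ?_
      rw [hP]
      push_cast
      ring
  refine ⟨⟨u, w, (hsys u w).2 hu, hw0, hun, ?_⟩, ?_⟩
  · rw [Finset.sum_congr rfl fun k hk =>
      conj_pole_pair_eq hr0 (hθlb k hk) (hlam k) (hy k) (hs k hk)]
    simp [u, hP0, Finset.mul_sum]
  · intro u₁ w₁ u₂ w₂ h₁ hw₁ hu₁ h₂ hw₂ hu₂
    rw [hsys] at h₁ h₂
    have key := staggered_homogeneous_eq_zero (c := fun j => (c (j - 1) : ℂ))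
      (b := fun j => (b (j - 1) : ℂ)) (d := fun j => u₁ j - u₂ j) (e := fun j => w₁ j - w₂ j)
      hu hw0 hun
      (by
        intro j hj
        obtain ⟨h3, h4⟩ := h₁ j hj
        obtain ⟨h5, h6⟩ := h₂ j hj
        exact ⟨by linear_combination h3 - h5, by linear_combination h4 - h6⟩)
      (by simp [hw₁, hw₂]) (by simp [hu₁, hu₂])
    constructor
    · intro j hj
      have hj' := Finset.mem_Icc.1 hj
      have h := (key (j - 1) (by omega)).1
      rw [Nat.sub_add_cancel hj'.1] at h
      exact sub_eq_zero.1 h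
    · intro j hj
      exact sub_eq_zero.1 (key j (Finset.mem_Icc.1 hj).2).2
end

section
/- Let m ≥ 1 and let A, A′ ∈ M_m(ℂ) be tridiagonal complex symmetric matrices (A_{jk} = 0 whenever |j − k| > 1 and A_{j,j+1} = A_{j+1,j}, likewise for A′) all of whose off-diagonal entries are nonzero. Suppose there is a nonempty open set U ⊆ ℂ such that for every s ∈ U both A + s·I and A′ + s·I are invertible and e₁ᵀ(A + s·I)^{-1}e₁ = e₁ᵀ(A′ + s·I)^{-1}e₁, where e₁ is the first standard basis vector. Then A_{jj} = A′_{jj} for all j = 1, …, m, and (A_{j,j+1})² = (A′_{j,j+1})² for all j = 1, …, m−1. -/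
open Matrix

/-- Expansion of a determinant whose first row and column are supported on two entries. -/
theorem Matrix.det_eq_of_first_row_col_tridiagonal {R : Type*} [CommRing R] {n : ℕ}
    (B : Matrix (Fin (n + 2)) (Fin (n + 2)) R)
    (hrow : ∀ j : Fin n, B 0 j.succ.succ = 0) (hcol : ∀ j : Fin n, B j.succ.succ 0 = 0) :
    B.det = B 0 0 * (B.submatrix Fin.succ Fin.succ).det -
      B 0 1 * B 1 0 * ((B.submatrix Fin.succ Fin.succ).submatrix Fin.succ Fin.succ).det := by
  have hminor : (B.submatrix Fin.succ (Fin.succAbove 1)).det =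
      B 1 0 * ((B.submatrix Fin.succ Fin.succ).submatrix Fin.succ Fin.succ).det := by
    rw [det_succ_column_zero, Fin.sum_univ_succ, Finset.sum_eq_zero]
    · have hsub : (B.submatrix Fin.succ (Fin.succAbove 1)).submatrix (Fin.succAbove 0) Fin.succ =
          (B.submatrix Fin.succ Fin.succ).submatrix Fin.succ Fin.succ := by
        ext i j
        simp [Fin.one_succAbove_succ]
      rw [hsub]
      simp
    · intro i _
      simp [hcol]
  rw [det_succ_row_zero, Fin.sum_univ_succ, Fin.sum_univ_succ, Finset.sum_eq_zero]
  · simp only [Fin.succ_zero_eq_one, hminor]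
    simp
    ring
  · intro i _
    simp [hrow]

open Polynomial in
/-- The three-term recurrence for characteristic polynomials of trailing submatrices. -/
theorem Matrix.charpoly_eq_of_first_row_col_tridiagonal {R : Type*} [CommRing R] {n : ℕ}
    (B : Matrix (Fin (n + 2)) (Fin (n + 2)) R)
    (hrow : ∀ j : Fin n, B 0 j.succ.succ = 0) (hcol : ∀ j : Fin n, B j.succ.succ 0 = 0) :
    B.charpoly = (X - C (B 0 0)) * (B.submatrix Fin.succ Fin.succ).charpoly -
      C (B 0 1 * B 1 0) *
        ((B.submatrix Fin.succ Fin.succ).submatrix Fin.succ Fin.succ).charpoly := by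
  have hsub {k : ℕ} (M : Matrix (Fin (k + 1)) (Fin (k + 1)) R) :
      (M.charmatrix).submatrix Fin.succ Fin.succ = (M.submatrix Fin.succ Fin.succ).charmatrix := by
    ext1 i j
    simp [charmatrix_apply, diagonal_apply]
  have h01 : (0 : Fin (n + 2)) ≠ 1 := by simp
  rw [charpoly, det_eq_of_first_row_col_tridiagonal, hsub, hsub, charpoly, charpoly,
    charmatrix_apply_eq, charmatrix_apply_ne _ _ _ h01, charmatrix_apply_ne _ _ _ h01.symm]
  · simp
  · intro j
    rw [charmatrix_apply_ne _ _ _ (Fin.succ_ne_zero _).symm, hrow, C_0, neg_zero]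
  · intro j
    rw [charmatrix_apply_ne _ _ _ (Fin.succ_ne_zero _), hcol, C_0, neg_zero]

open Polynomial in
/-- A Jacobi matrix is determined, up to signs of its off-diagonal entries, by the quotient of the
characteristic polynomials of its first trailing submatrix and of the matrix itself. -/
theorem Matrix.tridiagonal_unique_of_charpoly_mul_eq {K : Type*} [Field K] (n : ℕ)
    (A A' : Matrix (Fin (n + 1)) (Fin (n + 1)) K)
    (hAtri : ∀ j k : Fin (n + 1), (j.val + 2 ≤ k.val ∨ k.val + 2 ≤ j.val) → A j k = 0)
    (hA'tri : ∀ j k : Fin (n + 1), (j.val + 2 ≤ k.val ∨ k.val + 2 ≤ j.val) → A' j k = 0)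
    (hAsymm : A.IsSymm) (hA'symm : A'.IsSymm)
    (hAoff : ∀ j k : Fin (n + 1), k.val = j.val + 1 → A j k ≠ 0)
    (h : (A.submatrix Fin.succ Fin.succ).charpoly * A'.charpoly =
      (A'.submatrix Fin.succ Fin.succ).charpoly * A.charpoly) :
    (∀ j, A j j = A' j j) ∧
      ∀ j k : Fin (n + 1), k.val = j.val + 1 → A j k ^ 2 = A' j k ^ 2 := by
  induction n with
  | zero =>
    refine ⟨fun j => ?_, fun j k hjk => by omega⟩
    have hone (M : Matrix (Fin 0) (Fin 0) K) : M.charpoly = 1 := det_isEmpty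
    rw [hone, hone, one_mul, one_mul] at h
    obtain rfl : j = 0 := Fin.fin_one_eq_zero j
    have h0 := congrArg (eval 0) h
    simpa [eval_charpoly] using h0.symm
  | succ n ih =>
    set B := A.submatrix Fin.succ Fin.succ with hB
    set B' := A'.submatrix Fin.succ Fin.succ with hB'
    have hrec := charpoly_eq_of_first_row_col_tridiagonal A
      (fun j => hAtri _ _ (by simp)) (fun j => hAtri _ _ (by simp))
    have hrec' := charpoly_eq_of_first_row_col_tridiagonal A'
      (fun j => hA'tri _ _ (by simp)) (fun j => hA'tri _ _ (by simp))
    rw [hAsymm.apply 0 1, ← sq, ← hB] at hrec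
    rw [hA'symm.apply 0 1, ← sq, ← hB'] at hrec'
    set D := B.submatrix Fin.succ Fin.succ
    set D' := B'.submatrix Fin.succ Fin.succ
    have hBm := B.charpoly_monic
    have hB'm := B'.charpoly_monic
    have hDm := D.charpoly_monic
    have hD'm := D'.charpoly_monic
    have hBd : B.charpoly.natDegree = n + 1 := by simp [charpoly_natDegree_eq_dim]
    have hB'd : B'.charpoly.natDegree = n + 1 := by simp [charpoly_natDegree_eq_dim]
    have hDd : D.charpoly.natDegree = n := by simp [charpoly_natDegree_eq_dim]
    have hD'd : D'.charpoly.natDegree = n := by simp [charpoly_natDegree_eq_dim]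
    have hdiff : C (A 0 0 - A' 0 0) * (B.charpoly * B'.charpoly) =
        C (A' 0 1 ^ 2) * (B.charpoly * D'.charpoly) -
          C (A 0 1 ^ 2) * (B'.charpoly * D.charpoly) := by
      rw [hrec, hrec'] at h
      rw [C_sub]
      linear_combination h
    have hBB' : (B.charpoly * B'.charpoly).coeff (n + 1 + (n + 1)) = 1 := by
      have hdeg := hBm.natDegree_mul hB'm
      rw [hBd, hB'd] at hdeg
      exact hdeg ▸ (hBm.mul hB'm).coeff_natDegree
    have hdegBD' : (B.charpoly * D'.charpoly).natDegree = n + 1 + n := by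
      rw [hBm.natDegree_mul hD'm, hBd, hD'd]
    have hdegB'D : (B'.charpoly * D.charpoly).natDegree = n + 1 + n := by
      rw [hB'm.natDegree_mul hDm, hB'd, hDd]
    have hdiag : A 0 0 = A' 0 0 := by
      have hc := congrArg (fun p => p.coeff (n + 1 + (n + 1))) hdiff
      simp only [coeff_sub, coeff_C_mul, hBB'] at hc
      rw [coeff_eq_zero_of_natDegree_lt (by omega), coeff_eq_zero_of_natDegree_lt (by omega)] at hc
      simpa [sub_eq_zero] using hc
    have hprod : C (A' 0 1 ^ 2) * (B.charpoly * D'.charpoly) =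
        C (A 0 1 ^ 2) * (B'.charpoly * D.charpoly) := by
      rw [hdiag, sub_self, C_0, zero_mul] at hdiff
      exact sub_eq_zero.mp hdiff.symm
    have hoff : A 0 1 ^ 2 = A' 0 1 ^ 2 := by
      have hl := congrArg leadingCoeff hprod
      rw [leadingCoeff_mul_monic (hBm.mul hD'm), leadingCoeff_mul_monic (hB'm.mul hDm),
        leadingCoeff_C, leadingCoeff_C] at hl
      exact hl.symm
    have hne : C (A 0 1 ^ 2) ≠ 0 := C_ne_zero.mpr (pow_ne_zero 2 (hAoff 0 1 (by simp)))
    rw [← hoff] at hprod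
    have hnext := mul_left_cancel₀ hne hprod
    obtain ⟨ihdiag, ihoff⟩ := ih B B'
      (fun j k hjk => hAtri _ _ (by simp only [Fin.val_succ]; omega))
      (fun j k hjk => hA'tri _ _ (by simp only [Fin.val_succ]; omega))
      (hAsymm.submatrix _) (hA'symm.submatrix _)
      (fun j k hjk => hAoff _ _ (by simp only [Fin.val_succ]; omega))
      (by linear_combination -hnext)
    refine ⟨fun j => Fin.cases hdiag ihdiag j, fun j k hjk => ?_⟩
    cases k using Fin.cases with
    | zero => simp at hjk
    | succ k =>
      cases j using Fin.cases with
      | zero =>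
        have hk : k.succ = 1 := Fin.ext (by simpa using hjk)
        rw [hk, hoff]
      | succ j => exact ihoff j k (by simpa using hjk)

theorem Matrix.eval_charpoly_neg {R n : Type*} [CommRing R] [Fintype n] [DecidableEq n]
    (A : Matrix n n R) (s : R) : (-A).charpoly.eval s = (A + s • (1 : Matrix n n R)).det := by
  rw [eval_charpoly, sub_neg_eq_add, add_comm, scalar_apply, smul_one_eq_diagonal]

/-- The leading entry of the resolvent as a quotient of characteristic polynomials. -/
theorem Matrix.resolvent_zero_zero {K : Type*} [Field K] {n : ℕ}
    (A : Matrix (Fin (n + 1)) (Fin (n + 1)) K) (s : K) :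
    (A + s • (1 : Matrix (Fin (n + 1)) (Fin (n + 1)) K))⁻¹ 0 0 =
      ((-A).submatrix Fin.succ Fin.succ).charpoly.eval s / (-A).charpoly.eval s := by
  have hsub : (A + s • (1 : Matrix (Fin (n + 1)) (Fin (n + 1)) K)).submatrix Fin.succ Fin.succ =
      scalar (Fin n) s - (-A).submatrix Fin.succ Fin.succ := by
    ext i j
    simp [diagonal_apply, one_apply, add_comm]
  rw [eval_charpoly_neg, eval_charpoly, ← hsub, inv_def, smul_apply,
    adjugate_fin_succ_eq_det_submatrix, Ring.inverse_eq_inv']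
  simp [div_eq_inv_mul]

/- STATEMENT 15: uniqueness of the complex symmetric tridiagonal realization — if two
   such matrices with nonzero off-diagonal entries have the same (1,1) resolvent entry
   on a nonempty open set, their diagonals agree and the squares of their off-diagonal
   entries agree. -/
theorem stmt15 (m : ℕ) (hm : 1 ≤ m) (A A' : Matrix (Fin m) (Fin m) ℂ)
    (hAtri : ∀ j k : Fin m, (j.val + 2 ≤ k.val ∨ k.val + 2 ≤ j.val) → A j k = 0)
    (hA'tri : ∀ j k : Fin m, (j.val + 2 ≤ k.val ∨ k.val + 2 ≤ j.val) → A' j k = 0)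
    (hAsymm : Aᵀ = A) (hA'symm : A'ᵀ = A')
    (hAoff : ∀ j k : Fin m, k.val = j.val + 1 → A j k ≠ 0)
    (hA'off : ∀ j k : Fin m, k.val = j.val + 1 → A' j k ≠ 0)
    (U : Set ℂ) (hUopen : IsOpen U) (hUne : U.Nonempty)
    (hinv : ∀ s ∈ U,
      IsUnit (A + s • (1 : Matrix (Fin m) (Fin m) ℂ)).det ∧
      IsUnit (A' + s • (1 : Matrix (Fin m) (Fin m) ℂ)).det)
    (hmatch : ∀ s ∈ U,
      (fun i : Fin m => if i.val = 0 then (1 : ℂ) else 0) ⬝ᵥ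
        ((A + s • (1 : Matrix (Fin m) (Fin m) ℂ))⁻¹ *ᵥ
          fun i : Fin m => if i.val = 0 then (1 : ℂ) else 0) =
      (fun i : Fin m => if i.val = 0 then (1 : ℂ) else 0) ⬝ᵥ
        ((A' + s • (1 : Matrix (Fin m) (Fin m) ℂ))⁻¹ *ᵥ
          fun i : Fin m => if i.val = 0 then (1 : ℂ) else 0)) :
    (∀ j : Fin m, A j j = A' j j) ∧
    (∀ j k : Fin m, k.val = j.val + 1 → (A j k) ^ 2 = (A' j k) ^ 2) := by
  obtain ⟨n, rfl⟩ : ∃ n, m = n + 1 := ⟨m - 1, by omega⟩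
  have he : (fun i : Fin (n + 1) => if i.val = 0 then (1 : ℂ) else 0) = Pi.single 0 1 := by
    ext i
    simp only [Pi.single_apply, Fin.ext_iff, Fin.val_zero]
  have hU : U.Infinite := by
    obtain ⟨x, hx⟩ := hUne
    exact infinite_of_mem_nhds x (hUopen.mem_nhds hx)
  have hpoly : ((-A).submatrix Fin.succ Fin.succ).charpoly * (-A').charpoly =
      ((-A').submatrix Fin.succ Fin.succ).charpoly * (-A).charpoly := by
    refine Polynomial.eq_of_infinite_eval_eq _ _ (hU.mono fun s hs => ?_)
    have hs' := hmatch s hs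
    simp only [he, mulVec_single_one, single_one_dotProduct, col_apply] at hs'
    rw [resolvent_zero_zero, resolvent_zero_zero, div_eq_div_iff] at hs'
    · simpa using hs'
    · exact eval_charpoly_neg A s ▸ (hinv s hs).1.ne_zero
    · exact eval_charpoly_neg A' s ▸ (hinv s hs).2.ne_zero
  have hA : A.IsSymm := hAsymm
  have hA' : A'.IsSymm := hA'symm
  simpa using tridiagonal_unique_of_charpoly_mul_eq n (-A) (-A')
    (fun j k hjk => by simp [hAtri j k hjk]) (fun j k hjk => by simp [hA'tri j k hjk])
    hA.neg hA'.neg (fun j k hjk => neg_ne_zero.mpr (hAoff j k hjk)) hpoly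
end
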